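/- For every positive integer n, the following identity of formal power series in x_0,x_1,x_2,… with polynomial coefficients in q holds: the sum over all fully commutative signed permutations w ∈ FC(B_n) having at least one negative entry (i.e., w ∈ FC(B_n)∖FC(S_n)) of q^{bl(w^{-1})}·F^B_{Des_B(w)}(x_0,x_1,…) equals Σ_{k=1}^{n} (Σ_{j=0}^{n} b_{n,k,j} q^j)·h_k(x_1,x_2,…)·h_{n−k}(x_0,x_1,…). In particular all coefficients b_{n,k,j} are nonnegative. -/

import Mathlib

open scoped Classical

noncomputable section

namespace Paper

/-- Membership in the hyperoctahedral group `B_n`, realized inside `Equiv.Perm ℤ`: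
`w(-i) = -w(i)` and `w` fixes every integer of absolute value larger than `n`. -/
def InB (n : ℕ) (w : Equiv.Perm ℤ) : Prop :=
  (∀ i : ℤ, w (-i) = - w i) ∧ ∀ i : ℤ, (n : ℤ) < |i| → w i = i

/-- Window entry `w_i` with the convention `w_0 = 0`. -/
def went (w : Equiv.Perm ℤ) (i : ℕ) : ℤ := if i = 0 then 0 else w (i : ℤ)

/-- Stembridge's pattern criterion: `w ∈ B_n` is fully commutative iff there are no
indices `i<j` with `0 > w_i > w_j`, no `i<j<k` with `|w_i| > w_j > w_k`, and no
`i<j<k` with `-w_j > |w_i| > w_k`. -/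
def IsFC (n : ℕ) (w : Equiv.Perm ℤ) : Prop :=
  InB n w ∧
  (¬ ∃ i j : ℕ, 1 ≤ i ∧ i < j ∧ j ≤ n ∧ w (j : ℤ) < w (i : ℤ) ∧ w (i : ℤ) < 0) ∧
  (¬ ∃ i j k : ℕ, 1 ≤ i ∧ i < j ∧ j < k ∧ k ≤ n ∧
      w (j : ℤ) < |w (i : ℤ)| ∧ w (k : ℤ) < w (j : ℤ)) ∧
  (¬ ∃ i j k : ℕ, 1 ≤ i ∧ i < j ∧ j < k ∧ k ≤ n ∧
      |w (i : ℤ)| < - w (j : ℤ) ∧ w (k : ℤ) < |w (i : ℤ)|)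

/-- Membership in `S_n ⊆ B_n`: all window entries positive. -/
def InS (n : ℕ) (w : Equiv.Perm ℤ) : Prop :=
  InB n w ∧ ∀ i : ℕ, 1 ≤ i → i ≤ n → 0 < w (i : ℤ)

/-- 321-avoidance of the window. -/
def Avoids321 (n : ℕ) (w : Equiv.Perm ℤ) : Prop :=
  ¬ ∃ i j k : ℕ, 1 ≤ i ∧ i < j ∧ j < k ∧ k ≤ n ∧
    w (k : ℤ) < w (j : ℤ) ∧ w (j : ℤ) < w (i : ℤ)

/-- Type-B descent set `Des_B(w) = {0 ≤ i ≤ n-1 : w_i > w_{i+1}}`, convention `w_0 = 0`. -/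
def DesB (n : ℕ) (w : Equiv.Perm ℤ) : Finset ℕ :=
  (Finset.range n).filter fun i => went w (i+1) < went w i

/-- Type-A descent set `Des(w) = {1 ≤ i ≤ n-1 : w_i > w_{i+1}}`. -/
def DesA (n : ℕ) (w : Equiv.Perm ℤ) : Finset ℕ :=
  (Finset.Ico 1 n).filter fun i => went w (i+1) < went w i

/-- Last descent: `ldes(w) = max (Des_B(w) ∪ {0})`. -/
def ldes (n : ℕ) (w : Equiv.Perm ℤ) : ℕ := (DesB n w).sup id

/-- `Neg(w) = {1 ≤ i ≤ n : w_i < 0}`. -/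
def NegSet (n : ℕ) (w : Equiv.Perm ℤ) : Finset ℕ :=
  (Finset.Icc 1 n).filter fun i => w (i : ℤ) < 0

/-- Block number `bl(w) = 1 + #{1 ≤ i ≤ n-1 : max(w_1,…,w_i) < min(w_{i+1},…,w_n)}`. -/
def bl (n : ℕ) (w : Equiv.Perm ℤ) : ℕ :=
  1 + ((Finset.Ioo 0 n).filter fun i : ℕ =>
    ∀ j ∈ Finset.Icc 1 i, ∀ k ∈ Finset.Icc (i + 1) n, w ((j : ℕ) : ℤ) < w ((k : ℕ) : ℤ)).card

/-- Chow's type-B fundamental quasi-symmetric function `F^B_J` in variables `x_0,x_1,…`: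
the sum of `x_{i_1} ⋯ x_{i_n}` over `0 ≤ i_1 ≤ ⋯ ≤ i_n` with `i_j < i_{j+1}` for `j ∈ J`,
with the convention `i_0 = 0`. A sequence is encoded by `f : ℕ → ℕ` with `f a = i_a`
for `1 ≤ a ≤ n`, normalized by `f 0 = 0` and `f a = 0` for `a > n`. -/
def FB (R : Type) [CommRing R] (n : ℕ) (J : Finset ℕ) : MvPowerSeries ℕ R :=
  fun m => (Nat.card {f : ℕ → ℕ //
    f 0 = 0 ∧ (∀ a, n < a → f a = 0) ∧
    (∀ a b, a ≤ b → b ≤ n → f a ≤ f b) ∧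
    (∀ j ∈ J, f j < f (j + 1)) ∧
    ∀ v : ℕ, m v = ((Finset.Icc 1 n).filter fun a => f a = v).card} : R)

/-- Gessel's fundamental quasi-symmetric function `F_J` in variables `x_1,x_2,…`. -/
def FA (R : Type) [CommRing R] (n : ℕ) (J : Finset ℕ) : MvPowerSeries ℕ R :=
  fun m => (Nat.card {f : ℕ → ℕ //
    f 0 = 0 ∧ (∀ a, n < a → f a = 0) ∧
    (∀ a, 1 ≤ a → a ≤ n → 1 ≤ f a) ∧
    (∀ a b, 1 ≤ a → a ≤ b → b ≤ n → f a ≤ f b) ∧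
    (∀ j ∈ J, f j < f (j + 1)) ∧
    ∀ v : ℕ, m v = ((Finset.Icc 1 n).filter fun a => f a = v).card} : R)

/-- Complete homogeneous symmetric function `h_m` in the variables `x_s, x_{s+1}, …`. -/
def hSeries (R : Type) [CommRing R] (s m : ℕ) : MvPowerSeries ℕ R :=
  fun μ => if (μ.sum fun _ v => v) = m ∧ ∀ a < s, μ a = 0 then 1 else 0

/-- Number of semistandard Young tableaux of shape `lam` (row lengths `lam 0 ≥ lam 1 ≥ …`),
with all entries `≥ s`, rows weakly increasing, columns strictly increasing,
and content `μ` (the value `v` occurs `μ v` times). Tableaux are normalized to be `0`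
outside the cells of the diagram. -/
def schurCoeff (s : ℕ) (lam : ℕ → ℕ) (μ : ℕ → ℕ) : ℕ :=
  Nat.card {T : ℕ → ℕ → ℕ //
    (∀ i j, j + 1 < lam i → T i j ≤ T i (j + 1)) ∧
    (∀ i j, j < lam (i + 1) → T i j < T (i + 1) j) ∧
    (∀ i j, j < lam i → s ≤ T i j) ∧
    (∀ i j, ¬ j < lam i → T i j = 0) ∧
    ∀ v : ℕ, μ v = Nat.card {p : ℕ × ℕ // p.2 < lam p.1 ∧ T p.1 p.2 = v}}

/-- The Schur function `s_lam` in the variables `x_s, x_{s+1}, …`. -/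
def schurS (R : Type) [CommRing R] (s : ℕ) (lam : ℕ → ℕ) : MvPowerSeries ℕ R :=
  fun m => (schurCoeff s lam (fun v => m v) : R)

/-- The two-row shape `(a, b)` as a row-length function. -/
def twoRow (a b : ℕ) : ℕ → ℕ := fun i => if i = 0 then a else if i = 1 then b else 0

/-- Row-length function of a partition of `k`. -/
def partFun {k : ℕ} (p : Nat.Partition k) : ℕ → ℕ :=
  fun i => ((p.parts.sort (· ≤ ·)).reverse).getD i 0

/-- Conjugate of a row-length function. -/
def conjFun (lam : ℕ → ℕ) : ℕ → ℕ := fun j => Nat.card {i : ℕ // j < lam i}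

/-- Descent set of the standard Young tableau of skew shape `(n,k)/(k)` (resp. of the
bi-tableau of bi-shape `((k),(n-k))`) encoded by the set `S ⊆ {1,…,n}` of entries of the
length-`k` bottom row: `{1 ≤ i ≤ n-1 : i ∉ S, i+1 ∈ S}`. -/
def DesSet (n : ℕ) (S : Finset ℕ) : Finset ℕ :=
  (Finset.Ico 1 n).filter fun i => i ∉ S ∧ i + 1 ∈ S

/-- Last descent of the tableau encoded by `S`. -/
def ldesSet (n : ℕ) (S : Finset ℕ) : ℕ := (DesSet n S).sup id

/-- Type-B descent set of the bi-tableau encoded by `S`: add `0` when `1 ∈ S`. -/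
def DesBSet (n : ℕ) (S : Finset ℕ) : Finset ℕ :=
  if 1 ∈ S then insert 0 (DesSet n S) else DesSet n S

/-- `b_{n,k,j}`: the number of standard Young tableaux of skew shape `(n,k)/(k)`
(encoded by `k`-subsets `S ⊆ {1,…,n}`) with `ldes = n - j`. -/
def bCoeff (n k j : ℕ) : ℕ :=
  ((Finset.Icc 1 n).powerset.filter fun S => S.card = k ∧ ldesSet n S = n - j).card

/-- `a_{n,k,j}`: the number of standard Young tableaux of shape `(n-k,k)` (encoded by
`k`-subsets `S ⊆ {1,…,n}` of second-row entries satisfying the ballot condition)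
with `ldes = n - j`. -/
def aCoeff (n k j : ℕ) : ℕ :=
  ((Finset.Icc 1 n).powerset.filter fun S => S.card = k ∧
    (∀ i ∈ Finset.Icc 1 n, 2 * (S.filter (· ≤ i)).card ≤ i) ∧ ldesSet n S = n - j).card

/-- `e_{n,m,J}`: number of `m`-subsets `S ⊆ {1,…,n}` with `Des_B(S) = J`. -/
def eCoeff (n m : ℕ) (J : Finset ℕ) : ℕ :=
  ((Finset.Icc 1 n).powerset.filter fun S => S.card = m ∧ DesBSet n S = J).card

/-- `d_{n,m,j}`: number of `m`-subsets `S ⊆ {1,…,n}` with `ldes(S) = n - j`. -/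
def dCoeff (n m j : ℕ) : ℕ :=
  ((Finset.Icc 1 n).powerset.filter fun S => S.card = m ∧ ldesSet n S = n - j).card

/-- The palindromic representation `w^0 = [-w_n, …, -w_1, w_1, …, w_n]`,
as a function of the position `p ∈ {1,…,2n}`. -/
def wzero (n : ℕ) (w : Equiv.Perm ℤ) : ℕ → ℤ :=
  fun p => if p ≤ n then - w ((n : ℤ) + 1 - (p : ℤ)) else w ((p : ℤ) - (n : ℤ))

/-- Greene invariant: the maximal total size of a union of `j` increasing subsequences
of `w^0` (a set of positions is such a union iff it admits a coloring by `j` colors with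
each color class increasing). By Greene's theorem this equals `λ_1 + ⋯ + λ_j` for the
RSK shape `λ(w^0)`. -/
def greene (n : ℕ) (w : Equiv.Perm ℤ) (j : ℕ) : ℕ :=
  ((Finset.Icc 1 (2 * n)).powerset.filter fun P =>
    ∃ c : ℕ → Fin j, ∀ p ∈ P, ∀ q ∈ P, p < q → c p = c q →
      wzero n w p < wzero n w q).sup Finset.card

/-- First valley `v(π)`. -/
def firstValley (n : ℕ) (π : Equiv.Perm ℤ) : ℕ :=
  if h : ((DesA n π⁻¹).erase 1).Nonempty then ((DesA n π⁻¹).erase 1).min' h else n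

/-- Order key for the order `-1 <r -2 <r ⋯ <r -n <r 1 <r ⋯ <r n`. -/
def rkey (n : ℕ) (a : ℤ) : ℤ := if a < 0 then -a else a + n

/-- The r-descent set `rDes(w) = {1 ≤ i ≤ n-1 : w_i >r w_{i+1}}`. -/
def rDes (n : ℕ) (w : Equiv.Perm ℤ) : Finset ℕ :=
  (Finset.Ico 1 n).filter fun i : ℕ =>
    rkey n (w (((i : ℕ) + 1 : ℕ) : ℤ)) < rkey n (w ((i : ℕ) : ℤ))

/-- Poirier's type-B quasi-symmetric function `F^P_w(X,Y)`, a power series in the two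
alphabets `x_1,x_2,…` (indexed by `Sum.inl`) and `y_1,y_2,…` (indexed by `Sum.inr`). -/
def FP (n : ℕ) (w : Equiv.Perm ℤ) : MvPowerSeries (ℕ ⊕ ℕ) ℤ :=
  fun m => (Nat.card {f : ℕ → ℕ //
    f 0 = 0 ∧ (∀ a, n < a → f a = 0) ∧
    (∀ a, 1 ≤ a → a ≤ n → 1 ≤ f a) ∧
    (∀ a b, 1 ≤ a → a ≤ b → b ≤ n → f a ≤ f b) ∧
    (∀ j ∈ rDes n w, f j < f (j + 1)) ∧
    (∀ v : ℕ, m (Sum.inl v) =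
      ((Finset.Icc 1 n).filter fun a => f a = v ∧ 0 < w ((a : ℕ) : ℤ)).card) ∧
    ∀ v : ℕ, m (Sum.inr v) =
      ((Finset.Icc 1 n).filter fun a => f a = v ∧ w ((a : ℕ) : ℤ) < 0).card} : ℤ)

/-- The Schur function `s_lam(X)` in the first alphabet `x_1,x_2,…`. -/
def schurX (lam : ℕ → ℕ) : MvPowerSeries (ℕ ⊕ ℕ) ℤ :=
  fun m => if ∀ v, m (Sum.inr v) = 0 then
    (schurCoeff 1 lam fun v => m (Sum.inl v) : ℤ) else 0

/-- The Schur function `s_lam(Y)` in the second alphabet `y_1,y_2,…`. -/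
def schurY (lam : ℕ → ℕ) : MvPowerSeries (ℕ ⊕ ℕ) ℤ :=
  fun m => if ∀ v, m (Sum.inl v) = 0 then
    (schurCoeff 1 lam fun v => m (Sum.inr v) : ℤ) else 0

/-- Chow type-B Schur-positivity: a nonnegative combination of the products
`s_{λ⁻}(x_1,x_2,…) ⋅ s_{λ⁺}(x_0,x_1,…)` over pairs of partitions of total size `n`. -/
def ChowPos (n : ℕ) (F : MvPowerSeries ℕ ℤ) : Prop :=
  ∃ c : (Σ k : Fin (n + 1), Nat.Partition (k : ℕ) × Nat.Partition (n - (k : ℕ))) → ℕ,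
    F = ∑ p : (Σ k : Fin (n + 1), Nat.Partition (k : ℕ) × Nat.Partition (n - (k : ℕ))),
      (c p : ℤ) • (schurS ℤ 1 (partFun p.2.1) * schurS ℤ 0 (partFun p.2.2))

section LetterSums

variable {R : Type*} [CommRing R]

/-- Weighted count of the completions, by `r` further entries, of a one-parameter state `s`:
an entry either raises `s` by one, or lowers it to any value in `1, …, s`; the second kind of
entry is forbidden at position `n` when the previous entry was of the first kind (`l`) and
`A n` fails. A completed state has weight `q ^ s`. -/
def psi (q : R) (A : ℕ → Prop) : ℕ → ℕ → Bool → ℕ → R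
  | 0, _, _, s => q ^ s
  | r + 1, n, l, s => psi q A r (n + 1) true (s + 1) +
      if l = true ∧ ¬ A n then 0 else ∑ i ∈ Finset.Icc 1 s, psi q A r (n + 1) false i

/-- The analogue of `psi` for signed permutations in which each entry is larger in absolute
value than all previous ones if it is positive, and smaller if it is negative. -/
def freeVal (q : R) (A : ℕ → Prop) : ℕ → ℕ → Bool → R
  | 0, n, _ => q ^ n
  | r + 1, n, l => freeVal q A r (n + 1) true +
      if l = true ∧ ¬ A n then 0
      else freeVal q A r (n + 1) false + ∑ i ∈ Finset.Icc 1 n, psi q A r (n + 1) false i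

/-- Sum of `f (n - ldes T)` over the `k`-subsets `T ≠ {1, …, n}` of `{1, …, n}` containing `n`. -/
def deltaSum : ℕ → ℕ → (ℕ → R) → R
  | n + 2, k + 1, f => (n.choose k : R) * f 1 + deltaSum (n + 1) k fun s => f (s + 1)
  | _, _, _ => 0

/-- Sum of `f (n - ldes T)` over the `k`-subsets `T ≠ {1, …, k}` of `{1, …, n}`. -/
def gammaSum : ℕ → ℕ → (ℕ → R) → R
  | 0, _, _ => 0
  | n + 1, k, f => (gammaSum n k fun s => f (s + 1)) + deltaSum (n + 1) k f

lemma deltaSum_zero_right (n : ℕ) (f : ℕ → R) : deltaSum n 0 f = 0 := by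
  rcases n with _ | _ | n <;> simp [deltaSum]

lemma deltaSum_add (n k : ℕ) (f g : ℕ → R) :
    deltaSum n k (fun s => f s + g s) = deltaSum n k f + deltaSum n k g := by
  induction n generalizing k f g with
  | zero => simp [deltaSum]
  | succ n ih =>
    rcases n with _ | n <;> rcases k with _ | k <;> simp only [deltaSum, add_zero]
    rw [ih]; ring

lemma deltaSum_mul (n k : ℕ) (a : R) (f : ℕ → R) :
    deltaSum n k (fun s => a * f s) = a * deltaSum n k f := by
  induction n generalizing k f with
  | zero => simp [deltaSum]
  | succ n ih =>
    rcases n with _ | n <;> rcases k with _ | k <;> simp only [deltaSum, mul_zero]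
    rw [ih]; ring

lemma gammaSum_add (n k : ℕ) (f g : ℕ → R) :
    gammaSum n k (fun s => f s + g s) = gammaSum n k f + gammaSum n k g := by
  induction n generalizing f g with
  | zero => simp [gammaSum]
  | succ n ih => simp only [gammaSum, ih, deltaSum_add]; ring

lemma gammaSum_mul (n k : ℕ) (a : R) (f : ℕ → R) :
    gammaSum n k (fun s => a * f s) = a * gammaSum n k f := by
  induction n generalizing f with
  | zero => simp [gammaSum]
  | succ n ih => simp only [gammaSum, ih, deltaSum_mul]; ring

lemma deltaSum_eq_zero {n k : ℕ} (h : n ≤ k) (f : ℕ → R) : deltaSum n k f = 0 := by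
  induction n generalizing k f with
  | zero => simp [deltaSum]
  | succ n ih =>
    rcases n with _ | n <;> rcases k with _ | k <;> simp only [deltaSum]
    rw [ih (by omega), Nat.choose_eq_zero_of_lt (by omega)]; simp

lemma gammaSum_eq_zero {n k : ℕ} (h : n ≤ k) (f : ℕ → R) : gammaSum n k f = 0 := by
  induction n generalizing f with
  | zero => simp [gammaSum]
  | succ n ih => simp only [gammaSum]; rw [ih (by omega), deltaSum_eq_zero h, add_zero]

lemma gammaSum_zero_right (n : ℕ) (f : ℕ → R) : gammaSum n 0 f = 0 := by
  induction n generalizing f with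
  | zero => simp [gammaSum]
  | succ n ih => simp only [gammaSum]; rw [ih, deltaSum_zero_right, add_zero]

lemma deltaSum_one {n k : ℕ} (h : k ≤ n) :
    deltaSum (n + 1) k (fun _ => (1 : R)) + (n.choose k : R) = ((n + 1).choose k : R) := by
  induction n generalizing k with
  | zero => obtain rfl : k = 0 := by omega
            simp [deltaSum]
  | succ n ih =>
    rcases k with _ | k
    · simp [deltaSum_zero_right]
    · have := ih (k := k) (by omega)
      have h1 : ((n + 2).choose (k + 1) : R) = ((n + 1).choose k : R) + (n + 1).choose (k + 1) := by
        rw [Nat.choose_succ_succ' (n + 1) k]; push_cast; rfl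
      simp only [deltaSum]
      rw [h1, ← this]; ring

lemma gammaSum_one {n k : ℕ} (h : k ≤ n) :
    gammaSum n k (fun _ => (1 : R)) + 1 = (n.choose k : R) := by
  induction n with
  | zero => obtain rfl : k = 0 := by omega
            simp [gammaSum]
  | succ n ih =>
    rcases Nat.lt_or_ge n k with hk | hk
    · obtain rfl : k = n + 1 := by omega
      rw [gammaSum_eq_zero le_rfl]; simp
    · simp only [gammaSum]
      linear_combination ih hk + deltaSum_one (R := R) hk

lemma sum_Icc_one_succ (f : ℕ → R) (s : ℕ) :
    ∑ i ∈ Finset.Icc 1 (s + 1), f i = (∑ i ∈ Finset.Icc 1 s, f (i + 1)) + f 1 * 1 := by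
  rw [Finset.sum_Icc_succ_top (by omega)]
  induction s with
  | zero => simp
  | succ s ih => rw [Finset.sum_Icc_succ_top (by omega), Finset.sum_Icc_succ_top (by omega), ih]; ring

lemma deltaSum_sum {n k : ℕ} (h : k < n) (f : ℕ → R) :
    deltaSum n k (fun s => ∑ i ∈ Finset.Icc 1 s, f i) = deltaSum (n + 1) k f := by
  induction n generalizing k f with
  | zero => omega
  | succ n ih =>
    rcases k with _ | k
    · simp [deltaSum_zero_right]
    rcases n with _ | n
    · omega
    simp only [deltaSum, sum_Icc_one_succ, deltaSum_add, deltaSum_mul]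
    rw [ih (by omega)]
    have := deltaSum_one (R := R) (n := n) (k := k) (by omega)
    simp only [Finset.Icc_eq_empty_of_lt Nat.zero_lt_one, Finset.sum_empty, zero_add]
    linear_combination f 1 * this

lemma gammaSum_sum {n k : ℕ} (h : k ≤ n) (f : ℕ → R) :
    gammaSum n k (fun s => ∑ i ∈ Finset.Icc 1 s, f i) + ∑ i ∈ Finset.Icc 1 n, f i =
      deltaSum (n + 1) k f + gammaSum (n + 1) (k + 1) f := by
  induction n generalizing f with
  | zero => simp [gammaSum, deltaSum]
  | succ n ih =>
    rcases Nat.lt_or_ge n k with hk | hk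
    · obtain rfl : k = n + 1 := by omega
      rw [gammaSum_eq_zero le_rfl, gammaSum_eq_zero le_rfl, add_zero, zero_add]
      clear ih h hk
      induction n generalizing f with
      | zero => simp [deltaSum]
      | succ n ih =>
        rw [sum_Icc_one_succ, ih]
        simp only [deltaSum, Nat.choose_self]
        push_cast; ring
    · have h1 := ih hk fun s => f (s + 1)
      have h2 := gammaSum_one (R := R) hk
      have h3 : deltaSum (n + 2) (k + 1) f = (n.choose k : R) * f 1 +
        deltaSum (n + 1) k fun s => f (s + 1) := rfl
      have h4 : gammaSum (n + 2) (k + 1) f =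
        (gammaSum (n + 1) (k + 1) fun s => f (s + 1)) + deltaSum (n + 2) (k + 1) f := rfl
      have h5 : gammaSum (n + 1) k (fun s => ∑ i ∈ Finset.Icc 1 s, f i) =
        gammaSum n k (fun s => ∑ i ∈ Finset.Icc 1 (s + 1), f i) +
          deltaSum (n + 1) k (fun s => ∑ i ∈ Finset.Icc 1 s, f i) := rfl
      rw [deltaSum_sum (by omega)] at h5
      simp only [sum_Icc_one_succ, gammaSum_add, gammaSum_mul] at h5
      rw [h5, h4, h3, sum_Icc_one_succ]
      linear_combination h1 + f 1 * h2

variable (q : R) (A : ℕ → Prop)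

/-- `psi` and `freeVal` combined into the generating sum attached to the `k`-subsets of
`{1, …, n}`. -/
def subsetVal (r n : ℕ) (l : Bool) (k : ℕ) : R :=
  gammaSum n k (psi q A r n l) + freeVal q A r n l

lemma subsetVal_succ (r : ℕ) {n k : ℕ} (l : Bool) (h : k ≤ n) :
    subsetVal q A (r + 1) n l k =
      (subsetVal q A r (n + 1) true k - deltaSum (n + 1) k (psi q A r (n + 1) true)) +
      if l = true ∧ ¬ A n then 0 else
        subsetVal q A r (n + 1) false (k + 1) + deltaSum (n + 1) k (psi q A r (n + 1) false) := by
  have h1 : psi q A (r + 1) n l = fun s => psi q A r (n + 1) true (s + 1) +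
      if l = true ∧ ¬ A n then 0 else ∑ i ∈ Finset.Icc 1 s, psi q A r (n + 1) false i := rfl
  have h2 : gammaSum (n + 1) k (psi q A r (n + 1) true) =
    gammaSum n k (fun s => psi q A r (n + 1) true (s + 1)) +
      deltaSum (n + 1) k (psi q A r (n + 1) true) := rfl
  have h3 := gammaSum_sum h (psi q A r (n + 1) false)
  simp only [subsetVal, freeVal]
  rw [h1, gammaSum_add, h2]
  split_ifs
  · have : gammaSum n k (fun _ => (0 : R)) = 0 := by
      simpa using gammaSum_mul n k (0 : R) (fun _ => 0)
    rw [this]; ring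
  · linear_combination h3

lemma deltaSum_psi_succ (r : ℕ) {n k : ℕ} (l : Bool) (h : k < n) :
    deltaSum n k (psi q A (r + 1) n l) =
      deltaSum n k (fun s => psi q A r (n + 1) true (s + 1)) +
      if l = true ∧ ¬ A n then 0 else deltaSum (n + 1) k (psi q A r (n + 1) false) := by
  have h1 : psi q A (r + 1) n l = fun s => psi q A r (n + 1) true (s + 1) +
      if l = true ∧ ¬ A n then 0 else ∑ i ∈ Finset.Icc 1 s, psi q A r (n + 1) false i := rfl
  rw [h1, deltaSum_add]
  split_ifs
  · congr 1
    simpa using deltaSum_mul n k (0 : R) (fun _ => 0)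
  · rw [deltaSum_sum h]

/-- Contribution of a block prefix of length `c` none of whose entries is of the first kind. -/
def prefixVal (r n : ℕ) (l : Bool) (k c : ℕ) : R :=
  subsetVal q A r n l (k + c) + ∑ i ∈ Finset.range c, deltaSum n (k + i) (psi q A r n l)

/-- Total contribution of a block prefix of length `c`. -/
def blockVal (r n k c : ℕ) : R :=
  ∑ d ∈ Finset.range (c + 1), subsetVal q A r n true (k + d) - prefixVal q A r n true k c +
    prefixVal q A r n false k c

lemma blockVal_zero_right (r n k : ℕ) :
    blockVal q A r n k 0 = subsetVal q A r n false k := by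
  simp [blockVal, prefixVal]

lemma blockVal_succ_of_not (r : ℕ) {n k c : ℕ} (h : k + c ≤ n) (hA : ¬ A n ∨ c = 0) :
    blockVal q A (r + 1) n k c = blockVal q A r (n + 1) k (c + 1) := by
  have e1 : ∀ d ∈ Finset.range (c + 1), subsetVal q A (r + 1) n true (k + d) =
      (subsetVal q A r (n + 1) true (k + d) -
        deltaSum (n + 1) (k + d) (psi q A r (n + 1) true)) +
      if true = true ∧ ¬ A n then 0 else subsetVal q A r (n + 1) false (k + d + 1) +
        deltaSum (n + 1) (k + d) (psi q A r (n + 1) false) := fun d hd => by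
    rw [Finset.mem_range] at hd
    exact subsetVal_succ q A r true (by omega)
  have e2 : ∀ l, ∀ i ∈ Finset.range c, deltaSum n (k + i) (psi q A (r + 1) n l) =
      deltaSum n (k + i) (fun s => psi q A r (n + 1) true (s + 1)) +
      if l = true ∧ ¬ A n then 0 else deltaSum (n + 1) (k + i) (psi q A r (n + 1) false) :=
    fun l i hi => by
      rw [Finset.mem_range] at hi
      exact deltaSum_psi_succ q A r l (by omega)
  simp only [blockVal, prefixVal]
  rw [Finset.sum_congr rfl e1, Finset.sum_congr rfl (e2 true), Finset.sum_congr rfl (e2 false),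
    subsetVal_succ q A r true h, subsetVal_succ q A r false h]
  rcases hA with hA | rfl
  · simp only [hA, not_false_eq_true, and_self, if_true, Bool.false_eq_true, false_and, if_false,
      add_zero]
    rw [Finset.sum_add_distrib, Finset.sum_sub_distrib,
      Finset.sum_range_succ (fun d => subsetVal q A r (n + 1) true (k + d)) (c + 1),
      Finset.sum_range_succ (fun i => deltaSum (n + 1) (k + i) (psi q A r (n + 1) true)) c,
      Finset.sum_range_succ (fun i => deltaSum (n + 1) (k + i) (psi q A r (n + 1) false)) c]
    simp only [← add_assoc]
    ring
  · simp [Finset.sum_range_succ]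
    ring

lemma subsetVal_true (r : ℕ) {n k : ℕ} (hA : A n) :
    subsetVal q A r n true k = subsetVal q A r n false k := by
  have : psi q A r n true = psi q A r n false := by
    funext s; cases r <;> simp [psi, hA]
  have h2 : freeVal q A r n true = freeVal q A r n false := by
    cases r <;> simp [freeVal, hA]
  simp only [subsetVal, this, h2]

lemma blockVal_of_mem (r : ℕ) {n k c : ℕ} (hA : A n ∨ r = 0) :
    blockVal q A r n k c = ∑ d ∈ Finset.range (c + 1), blockVal q A r n (k + d) 0 := by
  have h0 : psi q A r n true = psi q A r n false := by
    rcases hA with hA | rfl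
    · funext s; cases r <;> simp [psi, hA]
    · rfl
  have h1 : ∀ k, subsetVal q A r n true k = subsetVal q A r n false k := by
    intro k
    rcases hA with hA | rfl
    · exact subsetVal_true q A r hA
    · rfl
  simp only [blockVal_zero_right]
  simp only [blockVal, prefixVal, h0, h1]
  ring

end LetterSums

section BlockSums

variable {R : Type*} [CommRing R] (q : R) (A : ℕ → Prop)

/-- The analogue of `freeVal` for completions of a positive increasing prefix, counting only
those completions which have a negative entry. -/
def idVal : ℕ → ℕ → R
  | 0, _ => 0
  | r + 1, n => idVal r (n + 1) + if ¬ A n then 0 else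
      freeVal q A r (n + 1) false + ∑ i ∈ Finset.Icc 1 n, psi q A r (n + 1) false i

lemma idVal_eq (r n : ℕ) : idVal q A r n = freeVal q A r n true - q ^ (n + r) := by
  induction r generalizing n with
  | zero => simp [idVal, freeVal]
  | succ r ih =>
    simp only [idVal, freeVal, ih, true_and]
    rw [show n + 1 + r = n + (r + 1) by ring]
    ring

lemma blockVal_zero_eq_sum {N n k c : ℕ} (hk : k ≤ n) (hN : n + c ≤ N) (hA : A (n + c))
    (hA' : ∀ i, n < i → i < n + c → ¬ A i) :
    blockVal q A (N - n) n k 0 =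
      ∑ d ∈ Finset.range (c + 1), blockVal q A (N - (n + c)) (n + c) (k + d) 0 := by
  have key : ∀ i ≤ c, blockVal q A (N - n) n k 0 = blockVal q A (N - (n + i)) (n + i) k i := by
    intro i hi
    induction i with
    | zero => rfl
    | succ i ih =>
      rw [ih (by omega), show N - (n + i) = (N - (n + (i + 1))) + 1 by omega,
        blockVal_succ_of_not q A _ (by omega)]
      · rfl
      · rcases i with _ | i
        · exact Or.inr rfl
        · exact Or.inl (hA' _ (by omega) (by omega))
  rw [key c le_rfl, blockVal_of_mem q A _ (Or.inl hA)]

lemma subsetVal_zero_right_of_not (r : ℕ) {n : ℕ} (hA : ¬ A n) :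
    subsetVal q A (r + 1) n true 0 = subsetVal q A r (n + 1) true 0 := by
  rw [subsetVal_succ q A r true (Nat.zero_le n), deltaSum_zero_right]
  simp [hA]

lemma sum_Iic_add_single {M : Type*} [AddCommMonoid M] (m : ℕ →₀ ℕ) {a : ℕ} (ha : m a = 0) (c : ℕ)
    (F : ℕ → M) :
    ∑ x ∈ Finset.Iic (m + Finsupp.single a c), F x.degree =
      ∑ x ∈ Finset.Iic m, ∑ d ∈ Finset.range (c + 1), F (x.degree + d) := by
  rw [← Finset.sum_product']
  symm
  refine Finset.sum_bij' (fun p _ => p.1 + Finsupp.single a p.2)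
    (fun y _ => (y.erase a, y a)) ?_ ?_ ?_ ?_ ?_
  · rintro ⟨x, d⟩ h
    simp only [Finset.mem_product, Finset.mem_Iic, Finset.mem_range] at h ⊢
    exact add_le_add h.1 (Finsupp.single_mono (by omega))
  · intro y h
    simp only [Finset.mem_product, Finset.mem_Iic, Finset.mem_range] at h ⊢
    have h' := Finsupp.le_def.1 h
    constructor
    · intro i
      have := h' i
      rcases eq_or_ne i a with rfl | hi
      · simp
      · simpa [Finsupp.erase_ne hi, Finsupp.single_apply, hi.symm] using this
    · have := h' a
      simp [ha] at this
      omega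
  · rintro ⟨x, d⟩ h
    simp only [Finset.mem_product, Finset.mem_Iic, Finset.mem_range] at h
    have hx : x a = 0 := by have := Finsupp.le_def.1 h.1 a; omega
    refine Prod.ext ?_ ?_
    · ext i
      rcases eq_or_ne i a with rfl | hi
      · simp [hx]
      · simp [Finsupp.erase_ne hi]
    · simp [hx]
  · intro y _
    exact Finsupp.erase_add_single a y
  · rintro ⟨x, d⟩ _
    simp

/-- The restriction of `m` to `{1, …, v}`. -/
def restrictIcc (m : ℕ →₀ ℕ) : ℕ → ℕ →₀ ℕ
  | 0 => 0
  | v + 1 => restrictIcc m v + Finsupp.single (v + 1) (m (v + 1))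

lemma restrictIcc_apply (m : ℕ →₀ ℕ) (v i : ℕ) :
    restrictIcc m v i = if 1 ≤ i ∧ i ≤ v then m i else 0 := by
  induction v with
  | zero => simp [restrictIcc]; omega
  | succ v ih =>
    simp only [restrictIcc, Finsupp.add_apply, ih, Finsupp.single_apply]
    rcases eq_or_ne (v + 1) i with rfl | h
    · simp
    · have : i ≤ v + 1 ↔ i ≤ v := by omega
      simp [h, this]

lemma degree_restrictIcc (m : ℕ →₀ ℕ) (v : ℕ) :
    m 0 + (restrictIcc m v).degree = ∑ u ∈ Finset.range (v + 1), m u := by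
  induction v with
  | zero => simp [restrictIcc]
  | succ v ih =>
    rw [Finset.sum_range_succ, ← ih]
    simp [restrictIcc, add_assoc]

lemma exists_restrictIcc_eq_erase (m : ℕ →₀ ℕ) : ∃ v, restrictIcc m v = m.erase 0 := by
  refine ⟨m.support.sup id, ?_⟩
  ext i
  rw [restrictIcc_apply]
  rcases eq_or_ne i 0 with rfl | hi
  · simp
  · rw [Finsupp.erase_ne hi]
    split_ifs with h
    · rfl
    · by_contra h'
      exact h ⟨by omega, Finset.le_sup (f := id) (Finsupp.mem_support_iff.2 (Ne.symm h'))⟩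

lemma idVal_eq_sum (m : ℕ →₀ ℕ) :
    idVal q (fun n => ∃ v, ∑ u ∈ Finset.range (v + 1), m u = n) m.degree 0 =
      ∑ x ∈ Finset.Iic (m.erase 0),
        (gammaSum m.degree x.degree (fun s => q ^ s) + q ^ m.degree) - q ^ m.degree := by
  set A : ℕ → Prop := fun n => ∃ v, ∑ u ∈ Finset.range (v + 1), m u = n with hA
  set P : ℕ → ℕ := fun v => ∑ u ∈ Finset.range (v + 1), m u with hP
  set N := m.degree with hN
  have hmono : Monotone P := monotone_nat_of_le_succ fun v => by
    simp only [hP]; rw [Finset.sum_range_succ _ (v + 1)]; omega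
  have hsucc : ∀ v, P (v + 1) = P v + m (v + 1) := fun v => Finset.sum_range_succ _ _
  obtain ⟨L, hL⟩ := exists_restrictIcc_eq_erase m
  have hPL : P L = N := by
    refine (degree_restrictIcc m L).symm.trans ?_
    rw [hL, hN]
    conv_rhs => rw [← Finsupp.single_add_erase 0 m]
    simp
  have hPN : ∀ v ≤ L, P v ≤ N := fun v hv => hPL ▸ hmono hv
  have h1 : ∀ v ≤ L, ∑ x ∈ Finset.Iic (restrictIcc m v),
      blockVal q A (N - P v) (P v) x.degree 0 = blockVal q A (N - P 0) (P 0) 0 0 := by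
    intro v hv
    induction v with
    | zero =>
      have : Finset.Iic (0 : ℕ →₀ ℕ) = {0} := by ext x; simp
      simp [restrictIcc, this]
    | succ v ih =>
      rw [← ih (by omega), restrictIcc,
        sum_Iic_add_single _ (by rw [restrictIcc_apply]; simp) _
          (fun k => blockVal q A (N - P (v + 1)) (P (v + 1)) k 0)]
      refine Finset.sum_congr rfl fun x hx => ?_
      have hxP : x.degree ≤ P v := by
        have h2 := degree_restrictIcc m v
        have h3 := Finsupp.degree_mono (Finset.mem_Iic.1 hx)
        simp only [hP]; omega
      rw [hsucc, blockVal_zero_eq_sum q A hxP (c := m (v + 1)) (by rw [← hsucc]; exact hPN _ hv)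
        ⟨v + 1, hsucc v⟩]
      rintro i hi hi' ⟨u, hu⟩
      rcases Nat.lt_or_ge v u with h | h
      · have := hmono h
        have := hsucc v
        simp only [Nat.succ_eq_add_one, hP] at *
        omega
      · have := hmono h
        simp only [hP] at *
        omega
  have h2 : ∀ n ≤ P 0, subsetVal q A N 0 true 0 = subsetVal q A (N - n) n true 0 := by
    intro n hn
    have := hPN 0 (Nat.zero_le _)
    induction n with
    | zero => rfl
    | succ n ih =>
      rw [ih (by omega), show N - n = (N - (n + 1)) + 1 by omega, subsetVal_zero_right_of_not]
      rintro ⟨u, hu⟩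
      have := hmono (Nat.zero_le u)
      simp only [hP] at *
      omega
  have h3 := h2 _ le_rfl
  rw [subsetVal_true q A _ ⟨0, rfl⟩, ← blockVal_zero_right, ← h1 L le_rfl, hPL, hL] at h3
  rw [idVal_eq]
  simp only [subsetVal, gammaSum, zero_add, Nat.sub_self, blockVal_zero_right] at h3
  rw [h3, zero_add]
  rfl

end BlockSums

section LastDescent

variable {R : Type*} [CommRing R]

lemma sum_powersetCard_Icc_succ {M : Type*} [AddCommMonoid M] (n k : ℕ) (g : Finset ℕ → M) :
    ∑ T ∈ (Finset.Icc 1 (n + 1)).powersetCard (k + 1), g T =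
      ∑ T ∈ (Finset.Icc 1 n).powersetCard (k + 1), g T +
        ∑ T ∈ (Finset.Icc 1 n).powersetCard k, g (insert (n + 1) T) := by
  have h : n + 1 ∉ Finset.Icc 1 n := by simp
  have hT : ∀ {j T}, T ∈ (Finset.Icc 1 n).powersetCard j → n + 1 ∉ T := fun hT h' =>
    h ((Finset.mem_powersetCard.1 hT).1 h')
  rw [← Finset.insert_Icc_right_eq_Icc_add_one (by omega), Finset.powersetCard_succ_insert h,
    Finset.sum_union, Finset.sum_image]
  · intro T hT1 T' hT1' e
    rw [← Finset.erase_insert (hT hT1), ← Finset.erase_insert (hT hT1'), e]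
  · rw [Finset.disjoint_left]
    intro T h1 h2
    obtain ⟨T', -, rfl⟩ := Finset.mem_image.1 h2
    exact hT h1 (Finset.mem_insert_self _ _)

lemma ldesSet_le (n : ℕ) (T : Finset ℕ) : ldesSet n T ≤ n - 1 :=
  Finset.sup_le fun i hi => by
    have := (Finset.mem_filter.1 hi).1
    rw [Finset.mem_Ico] at this
    simp only [id]; omega

lemma ldesSet_succ_of_notMem {n : ℕ} {T : Finset ℕ} (h : n + 1 ∉ T) :
    ldesSet (n + 1) T = ldesSet n T := by
  have : DesSet (n + 1) T = DesSet n T := by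
    ext i
    simp only [DesSet, Finset.mem_filter, Finset.mem_Ico]
    constructor
    · rintro ⟨⟨h1, h2⟩, h3, h4⟩
      rcases Nat.lt_or_ge i n with h5 | h5
      · exact ⟨⟨h1, h5⟩, h3, h4⟩
      · obtain rfl : i = n := by omega
        exact absurd h4 h
    · rintro ⟨⟨h1, h2⟩, h3⟩
      exact ⟨⟨h1, by omega⟩, h3⟩
  rw [ldesSet, ldesSet, this]

lemma ldesSet_insert_of_notMem {n : ℕ} {T : Finset ℕ} (hn : 1 ≤ n) (h : n ∉ T) :
    ldesSet (n + 1) (insert (n + 1) T) = n := by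
  refine le_antisymm (ldesSet_le _ _) (Finset.le_sup (f := id) (Finset.mem_filter.2 ⟨?_, ?_⟩))
  · simp [hn]
  · simp [h]

lemma ldesSet_insert_of_mem {n : ℕ} {T : Finset ℕ} (h : n ∈ T) (hT : n + 1 ∉ T) :
    ldesSet (n + 1) (insert (n + 1) T) = ldesSet n T := by
  have : DesSet (n + 1) (insert (n + 1) T) = DesSet n T := by
    ext i
    simp only [DesSet, Finset.mem_filter, Finset.mem_Ico, Finset.mem_insert]
    constructor
    · rintro ⟨⟨h1, h2⟩, h3, h4⟩
      rcases Nat.lt_or_ge i n with h5 | h5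
      · exact ⟨⟨h1, h5⟩, by tauto, h4.resolve_left (by omega)⟩
      · obtain rfl : i = n := by omega
        exact absurd (Or.inr h) h3
    · rintro ⟨⟨h1, h2⟩, h3, h4⟩
      exact ⟨⟨h1, by omega⟩, by simp [h3]; omega, Or.inr h4⟩
  rw [ldesSet, ldesSet, this]

lemma notMem_of_mem_powersetCard {n j i : ℕ} {T : Finset ℕ}
    (hT : T ∈ (Finset.Icc 1 n).powersetCard j) (hi : n < i) : i ∉ T := fun h => by
  have := (Finset.mem_powersetCard.1 hT).1 h
  rw [Finset.mem_Icc] at this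
  omega

lemma sum_ldesSet_insert (n k : ℕ) (f : ℕ → R) :
    ∑ T ∈ (Finset.Icc 1 n).powersetCard k, f (n + 1 - ldesSet (n + 1) (insert (n + 1) T)) =
      deltaSum (n + 1) (k + 1) f + if k = n then f (n + 1) else 0 := by
  induction n generalizing k f with
  | zero =>
    rcases k with _ | k
    · have : ldesSet 1 {1} = 0 := Nat.le_zero.1 (ldesSet_le 1 {1})
      simp [deltaSum, this]
    · rw [Finset.powersetCard_eq_empty.2 (by simp)]
      simp [deltaSum]
  | succ n ih =>
    have h1 : ∀ {j T}, T ∈ (Finset.Icc 1 n).powersetCard j →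
        f (n + 1 + 1 - ldesSet (n + 1 + 1) (insert (n + 1 + 1) T)) = f 1 := fun hT => by
      rw [ldesSet_insert_of_notMem (by omega) (notMem_of_mem_powersetCard hT (by omega))]
      congr 1; omega
    rcases k with _ | k
    · rw [Finset.powersetCard_zero, Finset.sum_singleton,
        h1 (j := 0) (T := ∅) (by simp)]
      simp [deltaSum, deltaSum_zero_right]
    · rw [sum_powersetCard_Icc_succ, Finset.sum_congr rfl fun T hT => h1 hT]
      simp only [deltaSum, Finset.sum_const, Finset.card_powersetCard, Nat.card_Icc,
        add_tsub_cancel_right, nsmul_eq_mul, add_assoc, add_left_inj]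
      have := ih k fun s => f (s + 1)
      simp only [add_assoc] at this
      rw [← this]
      congr 1
      refine Finset.sum_congr rfl fun T hT => ?_
      rw [show n + (1 + 1) = (n + 1) + 1 by ring, ldesSet_insert_of_mem (by simp)]
      · have := ldesSet_le (n + 1) (insert (n + 1) T)
        congr 1; omega
      · have := notMem_of_mem_powersetCard (i := n + 1 + 1) hT (by omega)
        simp [this]

lemma sum_ldesSet {n k : ℕ} (h : k ≤ n) (f : ℕ → R) :
    ∑ T ∈ (Finset.Icc 1 n).powersetCard k, f (n - ldesSet n T) = gammaSum n k f + f n := by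
  induction n generalizing k f with
  | zero =>
    obtain rfl : k = 0 := by omega
    simp [gammaSum]
  | succ n ih =>
    have h1 : ∀ {j T}, T ∈ (Finset.Icc 1 n).powersetCard j →
        f (n + 1 - ldesSet (n + 1) T) = f (n - ldesSet n T + 1) := fun hT => by
      rw [ldesSet_succ_of_notMem (notMem_of_mem_powersetCard hT (by omega))]
      have := ldesSet_le n
      congr 1; have := this ‹_›; omega
    rcases k with _ | k
    · rw [Finset.powersetCard_zero, Finset.sum_singleton,
        h1 (j := 0) (T := ∅) (by simp), gammaSum_zero_right]
      have := ih (k := 0) (by omega) fun s => f (s + 1)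
      rw [gammaSum_zero_right] at this
      simpa using this
    · rw [sum_powersetCard_Icc_succ, Finset.sum_congr rfl fun T hT => h1 hT, sum_ldesSet_insert]
      simp only [gammaSum]
      rcases Nat.lt_or_ge k n with hk | hk
      · rw [ih hk fun s => f (s + 1), if_neg (by omega)]
        ring
      · obtain rfl : k = n := by omega
        rw [Finset.powersetCard_eq_empty.2 (by simp), gammaSum_eq_zero (by omega)]
        simp

lemma sum_bCoeff {n k : ℕ} (h : k ≤ n) :
    ∑ j ∈ Finset.range (n + 1), (bCoeff n k j : Polynomial ℤ) * Polynomial.X ^ j =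
      gammaSum n k (fun s => Polynomial.X ^ s) + Polynomial.X ^ n := by
  rw [← sum_ldesSet h, ← Finset.sum_fiberwise_of_maps_to (t := Finset.range (n + 1))
    (g := fun T => n - ldesSet n T) (fun T _ => by simp)]
  refine Finset.sum_congr rfl fun j hj => ?_
  rw [Finset.mem_range] at hj
  rw [Finset.sum_congr rfl (g := fun _ => (Polynomial.X : Polynomial ℤ) ^ j) fun T hT => by
    rw [(Finset.mem_filter.1 hT).2], Finset.sum_const, nsmul_eq_mul, bCoeff]
  congr 3
  ext T
  have := ldesSet_le n T
  simp only [Finset.mem_filter, Finset.mem_powerset, Finset.mem_powersetCard, and_assoc]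
  have : ldesSet n T = n - j ↔ n - ldesSet n T = j := by omega
  rw [this]

end LastDescent

section Insertion

/-- The permutation `i ↦ i + 1` of `{g + 1, …, n}` with `n + 1 ↦ g + 1`, extended to an odd
function. -/
def rotate (n g : ℕ) : Equiv.Perm ℤ :=
  if h : g ≤ n then
    { toFun := fun i =>
        if i = n + 1 then g + 1 else if i = -(n + 1) then -(g + 1) else
        if g < i ∧ i ≤ n then i + 1 else if -n ≤ i ∧ i < -g then i - 1 else i
      invFun := fun i =>
        if i = g + 1 then n + 1 else if i = -(g + 1) then -(n + 1) else
        if g + 1 < i ∧ i ≤ n + 1 then i - 1 else if -(n + 1) ≤ i ∧ i < -(g + 1) then i + 1 else i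
      left_inv := fun i => by dsimp only; split_ifs <;> omega
      right_inv := fun i => by dsimp only; split_ifs <;> omega }
  else 1

lemma rotate_apply {n g : ℕ} (h : g ≤ n) (i : ℤ) :
    rotate n g i = if i = n + 1 then (g + 1 : ℤ) else if i = -(n + 1) then -(g + 1 : ℤ) else
        if g < i ∧ i ≤ n then i + 1 else if -n ≤ i ∧ i < -g then i - 1 else i := by
  rw [rotate, dif_pos h]
  rfl

/-- The signed permutation of size `n + 1` with last entry `g + 1` whose other entries are in the
same relative order as those of `w`. -/
def insP (n g : ℕ) (w : Equiv.Perm ℤ) : Equiv.Perm ℤ := rotate n g * w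

/-- The signed permutation of size `n + 1` with last entry `-(g + 1)` whose other entries are in
the same relative order as those of `w`. -/
def insN (n g : ℕ) (w : Equiv.Perm ℤ) : Equiv.Perm ℤ :=
  rotate n g * (Equiv.swap (n + 1 : ℤ) (-(n + 1)) * w)

/-- The relabelling of the entries caused by inserting an entry `± (g + 1)`. -/
def up (g : ℕ) (x : ℤ) : ℤ := if g < x then x + 1 else if x < -g then x - 1 else x

lemma InB.apply_zero {n : ℕ} {w : Equiv.Perm ℤ} (hw : InB n w) : w 0 = 0 := by
  have := hw.1 0
  simp only [neg_zero] at this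
  omega

lemma InB.apply_ne_zero {n : ℕ} {w : Equiv.Perm ℤ} (hw : InB n w) {i : ℤ} (hi : i ≠ 0) :
    w i ≠ 0 := fun h => hi (w.injective (h.trans hw.apply_zero.symm))

lemma InB.abs_apply_le {n : ℕ} {w : Equiv.Perm ℤ} (hw : InB n w) {i : ℤ} (hi : |i| ≤ n) :
    |w i| ≤ n := by
  by_contra h
  push Not at h
  rw [w.injective (hw.2 _ h)] at h
  omega

lemma InB.inv {n : ℕ} {w : Equiv.Perm ℤ} (hw : InB n w) : InB n w⁻¹ := by
  refine ⟨fun i => ?_, fun i hi => ?_⟩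
  · rw [Equiv.Perm.inv_eq_iff_eq, hw.1]; simp
  · rw [Equiv.Perm.inv_eq_iff_eq, hw.2 i hi]

lemma InB.one (n : ℕ) : InB n 1 := ⟨fun _ => rfl, fun _ _ => rfl⟩

lemma InB.exists_abs_eq {n : ℕ} {w : Equiv.Perm ℤ} (hw : InB n w) {a : ℕ} (ha : 1 ≤ a)
    (han : a ≤ n) : ∃ i : ℕ, 1 ≤ i ∧ i ≤ n ∧ |w (i : ℤ)| = a := by
  have h1 : |w⁻¹ (a : ℤ)| ≤ n := hw.inv.abs_apply_le (by simpa using han)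
  have h2 : w⁻¹ (a : ℤ) ≠ 0 := hw.inv.apply_ne_zero (by omega)
  rw [abs_le] at h1
  refine ⟨(w⁻¹ (a : ℤ)).natAbs, by omega, by omega, ?_⟩
  rcases abs_choice (w⁻¹ (a : ℤ)) with h | h <;> rw [Int.natCast_natAbs, h]
  · simp
  · rw [hw.1]; simp

section

variable {n g : ℕ} {w : Equiv.Perm ℤ}

lemma insP_apply (hw : InB n w) (hg : g ≤ n) {i : ℤ} (hi : |i| ≤ n) :
    insP n g w i = up g (w i) := by
  have := hw.abs_apply_le hi
  rw [abs_le] at this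
  rw [insP, Equiv.Perm.mul_apply, rotate_apply hg, up]
  split_ifs <;> omega

lemma insP_last (hw : InB n w) (hg : g ≤ n) : insP n g w (n + 1) = g + 1 := by
  rw [insP, Equiv.Perm.mul_apply, hw.2 _ (by rw [abs_of_nonneg] <;> omega), rotate_apply hg]
  simp

lemma insN_apply (hw : InB n w) (hg : g ≤ n) {i : ℤ} (hi : |i| ≤ n) :
    insN n g w i = up g (w i) := by
  have := hw.abs_apply_le hi
  rw [abs_le] at this
  rw [insN, Equiv.Perm.mul_apply, Equiv.Perm.mul_apply,
    Equiv.swap_apply_of_ne_of_ne (by omega) (by omega), rotate_apply hg, up]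
  split_ifs <;> omega

lemma insN_last (hw : InB n w) (hg : g ≤ n) : insN n g w (n + 1) = -(g + 1) := by
  rw [insN, Equiv.Perm.mul_apply, Equiv.Perm.mul_apply,
    hw.2 _ (by rw [abs_of_nonneg] <;> omega), Equiv.swap_apply_left, rotate_apply hg]
  split_ifs <;> omega

lemma rotate_neg (hg : g ≤ n) (i : ℤ) : rotate n g (-i) = -rotate n g i := by
  rw [rotate_apply hg, rotate_apply hg]
  split_ifs <;> omega

lemma rotate_of_lt (hg : g ≤ n) {i : ℤ} (hi : (n + 1 : ℕ) < |i|) : rotate n g i = i := by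
  rw [rotate_apply hg]
  rw [lt_abs] at hi
  push_cast at hi
  split_ifs <;> omega

lemma swap_neg (m i : ℤ) : Equiv.swap m (-m) (-i) = -Equiv.swap m (-m) i := by
  simp only [Equiv.swap_apply_def]
  split_ifs <;> omega

lemma InB.insP (hw : InB n w) (hg : g ≤ n) : InB (n + 1) (insP n g w) := by
  refine ⟨fun i => ?_, fun i hi => ?_⟩
  · rw [Paper.insP, Equiv.Perm.mul_apply, Equiv.Perm.mul_apply, hw.1, rotate_neg hg]
  · rw [Paper.insP, Equiv.Perm.mul_apply, hw.2 _ (by push_cast at hi; omega), rotate_of_lt hg hi]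

lemma InB.insN (hw : InB n w) (hg : g ≤ n) : InB (n + 1) (insN n g w) := by
  refine ⟨fun i => ?_, fun i hi => ?_⟩
  · simp only [Paper.insN, Equiv.Perm.mul_apply]
    rw [hw.1, swap_neg, rotate_neg hg]
  · have : i ≠ n + 1 ∧ i ≠ -(n + 1) := by
      rw [lt_abs] at hi; push_cast at hi; omega
    simp only [Paper.insN, Equiv.Perm.mul_apply]
    rw [hw.2 _ (by push_cast at hi; omega), Equiv.swap_apply_of_ne_of_ne this.1 this.2,
      rotate_of_lt hg hi]

end

/-- The elements of `B_n`. -/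
def signedPerms : ℕ → Finset (Equiv.Perm ℤ)
  | 0 => {1}
  | n + 1 => ((signedPerms n ×ˢ Finset.range (n + 1)).image fun p => insP n p.2 p.1) ∪
      ((signedPerms n ×ˢ Finset.range (n + 1)).image fun p => insN n p.2 p.1)

lemma inB_of_mul {n : ℕ} {σ w : Equiv.Perm ℤ} (hσ : InB (n + 1) σ) (hw : InB (n + 1) w)
    (h : w (n + 1) = σ (n + 1)) : InB n (σ⁻¹ * w) := by
  refine ⟨fun i => ?_, fun i hi => ?_⟩
  · rw [Equiv.Perm.mul_apply, Equiv.Perm.mul_apply, hw.1, hσ.inv.1]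
  · rw [Equiv.Perm.mul_apply, Equiv.Perm.inv_eq_iff_eq]
    rcases lt_or_ge ((n + 1 : ℕ) : ℤ) |i| with h' | h'
    · rw [hw.2 i h', hσ.2 i h']
    · have : i = n + 1 ∨ i = -(n + 1) := by
        rw [lt_abs] at hi; rw [abs_le] at h'; push_cast at h'; omega
      rcases this with rfl | rfl
      · exact h
      · rw [hw.1, hσ.1, h]

lemma mem_signedPerms {n : ℕ} {w : Equiv.Perm ℤ} : w ∈ signedPerms n ↔ InB n w := by
  induction n generalizing w with
  | zero =>
    simp only [signedPerms, Finset.mem_singleton]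
    refine ⟨fun h => h ▸ InB.one 0, fun h => Equiv.ext fun i => ?_⟩
    rcases eq_or_ne i 0 with rfl | hi
    · exact h.apply_zero
    · exact h.2 i (by simpa using hi)
  | succ n ih =>
    simp only [signedPerms, Finset.mem_union, Finset.mem_image, Finset.mem_product,
      Finset.mem_range, Prod.exists, ih]
    constructor
    · rintro (⟨w, g, ⟨hw, hg⟩, rfl⟩ | ⟨w, g, ⟨hw, hg⟩, rfl⟩)
      · exact hw.insP (by omega)
      · exact hw.insN (by omega)
    · intro hw
      have h1 := hw.abs_apply_le (i := n + 1) (by rw [abs_of_nonneg] <;> push_cast <;> omega)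
      have h2 := hw.apply_ne_zero (i := n + 1) (by omega)
      rw [abs_le] at h1
      push_cast at h1
      have hg : (w (n + 1)).natAbs - 1 ≤ n := by omega
      rcases lt_or_gt_of_ne h2 with h | h
      · refine Or.inr ⟨(insN n ((w (n + 1)).natAbs - 1) 1)⁻¹ * w, (w (n + 1)).natAbs - 1,
          ⟨inB_of_mul ((InB.one n).insN hg) hw ?_, by omega⟩, ?_⟩
        · rw [insN_last (InB.one n) hg]; omega
        · simp [insN, mul_assoc]
      · refine Or.inl ⟨(insP n ((w (n + 1)).natAbs - 1) 1)⁻¹ * w, (w (n + 1)).natAbs - 1,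
          ⟨inB_of_mul ((InB.one n).insP hg) hw ?_, by omega⟩, ?_⟩
        · rw [insP_last (InB.one n) hg]; omega
        · simp [insP]

lemma sum_signedPerms_succ {M : Type*} [AddCommMonoid M] (n : ℕ) (F : Equiv.Perm ℤ → M) :
    ∑ w ∈ signedPerms (n + 1), F w =
      ∑ w ∈ signedPerms n, ∑ g ∈ Finset.range (n + 1), (F (insP n g w) + F (insN n g w)) := by
  have hm : ∀ {p : Equiv.Perm ℤ × ℕ}, p ∈ signedPerms n ×ˢ Finset.range (n + 1) →
      InB n p.1 ∧ p.2 ≤ n := fun hp => by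
    rw [Finset.mem_product, mem_signedPerms, Finset.mem_range] at hp
    exact ⟨hp.1, by omega⟩
  rw [signedPerms, Finset.sum_union, Finset.sum_image, Finset.sum_image,
    ← Finset.sum_add_distrib, ← Finset.sum_product']
  · intro p hp p' hp' h
    have hg : p.2 = p'.2 := by
      have := insN_last (hm hp).1 (hm hp).2
      rw [show insN n p.2 p.1 = insN n p'.2 p'.1 from h, insN_last (hm hp').1 (hm hp').2] at this
      omega
    simp only [insN, hg] at h
    exact Prod.ext (mul_left_cancel (mul_left_cancel h)) hg
  · intro p hp p' hp' h
    have hg : p.2 = p'.2 := by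
      have := insP_last (hm hp).1 (hm hp).2
      rw [show insP n p.2 p.1 = insP n p'.2 p'.1 from h, insP_last (hm hp').1 (hm hp').2] at this
      omega
    simp only [insP, hg] at h
    exact Prod.ext (mul_left_cancel h) hg
  · rw [Finset.disjoint_left]
    intro w h1 h2
    obtain ⟨p, hp, rfl⟩ := Finset.mem_image.1 h1
    obtain ⟨p', hp', h⟩ := Finset.mem_image.1 h2
    have := insP_last (hm hp).1 (hm hp).2
    rw [← h, insN_last (hm hp').1 (hm hp').2] at this
    omega

end Insertion

section Patterns

lemma exists_pair_succ {n : ℕ} {Q : ℕ → ℕ → Prop} :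
    (∃ i j : ℕ, 1 ≤ i ∧ i < j ∧ j ≤ n + 1 ∧ Q i j) ↔
      (∃ i j : ℕ, 1 ≤ i ∧ i < j ∧ j ≤ n ∧ Q i j) ∨ ∃ i : ℕ, 1 ≤ i ∧ i ≤ n ∧ Q i (n + 1) := by
  constructor
  · rintro ⟨i, j, h1, h2, h3, h⟩
    rcases Nat.lt_or_ge n j with h4 | h4
    · obtain rfl : j = n + 1 := by omega
      exact Or.inr ⟨i, h1, by omega, h⟩
    · exact Or.inl ⟨i, j, h1, h2, h4, h⟩
  · rintro (⟨i, j, h1, h2, h3, h⟩ | ⟨i, h1, h2, h⟩)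
    · exact ⟨i, j, h1, h2, by omega, h⟩
    · exact ⟨i, n + 1, h1, by omega, le_rfl, h⟩

lemma exists_triple_succ {n : ℕ} {Q : ℕ → ℕ → ℕ → Prop} :
    (∃ i j k : ℕ, 1 ≤ i ∧ i < j ∧ j < k ∧ k ≤ n + 1 ∧ Q i j k) ↔
      (∃ i j k : ℕ, 1 ≤ i ∧ i < j ∧ j < k ∧ k ≤ n ∧ Q i j k) ∨
        ∃ i j : ℕ, 1 ≤ i ∧ i < j ∧ j ≤ n ∧ Q i j (n + 1) := by
  constructor
  · rintro ⟨i, j, k, h1, h2, h3, h4, h⟩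
    rcases Nat.lt_or_ge n k with h5 | h5
    · obtain rfl : k = n + 1 := by omega
      exact Or.inr ⟨i, j, h1, h2, by omega, h⟩
    · exact Or.inl ⟨i, j, k, h1, h2, h3, h5, h⟩
  · rintro (⟨i, j, k, h1, h2, h3, h4, h⟩ | ⟨i, j, h1, h2, h3, h⟩)
    · exact ⟨i, j, k, h1, h2, h3, by omega, h⟩
    · exact ⟨i, j, n + 1, h1, h2, by omega, le_rfl, h⟩

lemma exists_pair_congr {n : ℕ} {Q Q' : ℕ → ℕ → Prop}
    (h : ∀ i j, 1 ≤ i → i ≤ n → 1 ≤ j → j ≤ n → (Q i j ↔ Q' i j)) :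
    (∃ i j : ℕ, 1 ≤ i ∧ i < j ∧ j ≤ n ∧ Q i j) ↔ ∃ i j : ℕ, 1 ≤ i ∧ i < j ∧ j ≤ n ∧ Q' i j := by
  constructor <;> rintro ⟨i, j, h1, h2, h3, h4⟩ <;> refine ⟨i, j, h1, h2, h3, ?_⟩
  · exact (h i j h1 (by omega) (by omega) h3).1 h4
  · exact (h i j h1 (by omega) (by omega) h3).2 h4

lemma exists_triple_congr {n : ℕ} {Q Q' : ℕ → ℕ → ℕ → Prop}
    (h : ∀ i j k, 1 ≤ i → i ≤ n → 1 ≤ j → j ≤ n → 1 ≤ k → k ≤ n → (Q i j k ↔ Q' i j k)) :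
    (∃ i j k : ℕ, 1 ≤ i ∧ i < j ∧ j < k ∧ k ≤ n ∧ Q i j k) ↔
      ∃ i j k : ℕ, 1 ≤ i ∧ i < j ∧ j < k ∧ k ≤ n ∧ Q' i j k := by
  constructor <;> rintro ⟨i, j, k, h1, h2, h3, h4, h5⟩ <;> refine ⟨i, j, k, h1, h2, h3, h4, ?_⟩
  · exact (h i j k h1 (by omega) (by omega) (by omega) (by omega) h4).1 h5
  · exact (h i j k h1 (by omega) (by omega) (by omega) (by omega) h4).2 h5

lemma exists_congr_Icc {n : ℕ} {Q Q' : ℕ → Prop} (h : ∀ i, 1 ≤ i → i ≤ n → (Q i ↔ Q' i)) :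
    (∃ i : ℕ, 1 ≤ i ∧ i ≤ n ∧ Q i) ↔ ∃ i : ℕ, 1 ≤ i ∧ i ≤ n ∧ Q' i := by
  constructor <;> rintro ⟨i, h1, h2, h3⟩ <;> refine ⟨i, h1, h2, ?_⟩
  · exact (h i h1 h2).1 h3
  · exact (h i h1 h2).2 h3

variable {n g : ℕ} {w : Equiv.Perm ℤ}

/-- Appending the entry `g + 1` to `w` creates a forbidden pattern. -/
def BadP (n : ℕ) (w : Equiv.Perm ℤ) (g : ℕ) : Prop :=
  (∃ i j : ℕ, 1 ≤ i ∧ i < j ∧ j ≤ n ∧ w (j : ℤ) < |w (i : ℤ)| ∧ (g : ℤ) < w (j : ℤ)) ∨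
  (∃ i j : ℕ, 1 ≤ i ∧ i < j ∧ j ≤ n ∧ |w (i : ℤ)| < -w (j : ℤ) ∧ (g : ℤ) < |w (i : ℤ)|)

/-- Appending the entry `-(g + 1)` to `w` creates a forbidden pattern. -/
def BadN (n : ℕ) (w : Equiv.Perm ℤ) (g : ℕ) : Prop :=
  (∃ i : ℕ, 1 ≤ i ∧ i ≤ n ∧ -(g : ℤ) ≤ w (i : ℤ) ∧ w (i : ℤ) < 0) ∨
  (∃ i j : ℕ, 1 ≤ i ∧ i < j ∧ j ≤ n ∧ w (j : ℤ) < |w (i : ℤ)| ∧ -(g : ℤ) ≤ w (j : ℤ)) ∨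
  (∃ i j : ℕ, 1 ≤ i ∧ i < j ∧ j ≤ n ∧ |w (i : ℤ)| < -w (j : ℤ))

lemma up_lt_up {g : ℕ} {x y : ℤ} : up g x < up g y ↔ x < y := by
  unfold up; split_ifs <;> omega

lemma up_neg {g : ℕ} {x : ℤ} : up g (-x) = -up g x := by
  unfold up; split_ifs <;> omega

lemma abs_up {g : ℕ} {x : ℤ} : |up g x| = up g |x| := by
  rcases le_total 0 x with h | h
  · rw [abs_of_nonneg h, abs_of_nonneg]; unfold up; split_ifs <;> omega
  · rw [abs_of_nonpos h, abs_of_nonpos, up_neg]; unfold up; split_ifs <;> omega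

lemma up_lt_zero {g : ℕ} {x : ℤ} : up g x < 0 ↔ x < 0 := by
  unfold up; split_ifs <;> omega

lemma succ_lt_up {g : ℕ} {x : ℤ} : (g + 1 : ℤ) < up g x ↔ g < x := by
  unfold up; split_ifs <;> omega

lemma neg_succ_lt_up {g : ℕ} {x : ℤ} : -(g + 1 : ℤ) < up g x ↔ -(g : ℤ) ≤ x := by
  unfold up; split_ifs <;> omega

/-- The parameter of `w` corresponding to the parameter `g'` after inserting `± (g + 1)`. -/
def down (g g' : ℕ) : ℕ := if g' ≤ g then g' else g' - 1

lemma lt_up {g g' : ℕ} {x : ℤ} : (g' : ℤ) < up g x ↔ (down g g' : ℤ) < x := by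
  unfold up down; split_ifs <;> omega

lemma neg_le_up {g g' : ℕ} {x : ℤ} : -(g' : ℤ) ≤ up g x ↔ -(down g g' : ℤ) ≤ x := by
  unfold up down; split_ifs <;> omega

lemma natCast_abs_le {n i : ℕ} (h : i ≤ n) : |(i : ℤ)| ≤ n := by simpa using h

lemma insP_natCast (hw : InB n w) (hg : g ≤ n) {i : ℕ} (hi : i ≤ n) :
    insP n g w i = up g (w i) := insP_apply hw hg (natCast_abs_le hi)

lemma insN_natCast (hw : InB n w) (hg : g ≤ n) {i : ℕ} (hi : i ≤ n) :
    insN n g w i = up g (w i) := insN_apply hw hg (natCast_abs_le hi)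

lemma insP_succ (hw : InB n w) (hg : g ≤ n) : insP n g w ((n + 1 : ℕ) : ℤ) = g + 1 := by
  exact_mod_cast insP_last hw hg

lemma insN_succ (hw : InB n w) (hg : g ≤ n) : insN n g w ((n + 1 : ℕ) : ℤ) = -(g + 1) := by
  exact_mod_cast insN_last hw hg

section

variable {w' : Equiv.Perm ℤ}

lemma pair_neg_desc_up (e : ∀ {i : ℕ}, i ≤ n → w' (i : ℤ) = up g (w (i : ℤ))) :
    (∃ i j : ℕ, 1 ≤ i ∧ i < j ∧ j ≤ n ∧ w' (j : ℤ) < w' (i : ℤ) ∧ w' (i : ℤ) < 0) ↔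
      (∃ i j : ℕ, 1 ≤ i ∧ i < j ∧ j ≤ n ∧ w (j : ℤ) < w (i : ℤ) ∧ w (i : ℤ) < 0) :=
  exists_pair_congr fun i j _ hi _ hj => by
    rw [e hi, e hj, up_lt_up, up_lt_zero]

lemma triple_desc_desc_up (e : ∀ {i : ℕ}, i ≤ n → w' (i : ℤ) = up g (w (i : ℤ))) :
    (∃ i j k : ℕ, 1 ≤ i ∧ i < j ∧ j < k ∧ k ≤ n ∧ w' (j : ℤ) < |w' (i : ℤ)| ∧ w' (k : ℤ) < w' (j : ℤ)) ↔
      (∃ i j k : ℕ, 1 ≤ i ∧ i < j ∧ j < k ∧ k ≤ n ∧ w (j : ℤ) < |w (i : ℤ)| ∧ w (k : ℤ) < w (j : ℤ)) :=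
  exists_triple_congr fun i j k _ hi _ hj _ hk => by
    rw [e hi, e hj, e hk, abs_up, up_lt_up, up_lt_up]

lemma triple_neg_big_up (e : ∀ {i : ℕ}, i ≤ n → w' (i : ℤ) = up g (w (i : ℤ))) :
    (∃ i j k : ℕ, 1 ≤ i ∧ i < j ∧ j < k ∧ k ≤ n ∧ |w' (i : ℤ)| < -w' (j : ℤ) ∧ w' (k : ℤ) < |w' (i : ℤ)|) ↔
      (∃ i j k : ℕ, 1 ≤ i ∧ i < j ∧ j < k ∧ k ≤ n ∧ |w (i : ℤ)| < -w (j : ℤ) ∧ w (k : ℤ) < |w (i : ℤ)|) :=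
  exists_triple_congr fun i j k _ hi _ hj _ hk => by
    rw [e hi, e hj, e hk, abs_up, ← up_neg, up_lt_up, up_lt_up]

lemma pair_desc_succ_lt_up (e : ∀ {i : ℕ}, i ≤ n → w' (i : ℤ) = up g (w (i : ℤ))) :
    (∃ i j : ℕ, 1 ≤ i ∧ i < j ∧ j ≤ n ∧ w' (j : ℤ) < |w' (i : ℤ)| ∧ (g + 1 : ℤ) < w' (j : ℤ)) ↔
      (∃ i j : ℕ, 1 ≤ i ∧ i < j ∧ j ≤ n ∧ w (j : ℤ) < |w (i : ℤ)| ∧ (g : ℤ) < w (j : ℤ)) :=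
  exists_pair_congr fun i j _ hi _ hj => by
    rw [e hi, e hj, abs_up, up_lt_up, succ_lt_up]

lemma pair_neg_big_succ_lt_up (e : ∀ {i : ℕ}, i ≤ n → w' (i : ℤ) = up g (w (i : ℤ))) :
    (∃ i j : ℕ, 1 ≤ i ∧ i < j ∧ j ≤ n ∧ |w' (i : ℤ)| < -w' (j : ℤ) ∧ (g + 1 : ℤ) < |w' (i : ℤ)|) ↔
      (∃ i j : ℕ, 1 ≤ i ∧ i < j ∧ j ≤ n ∧ |w (i : ℤ)| < -w (j : ℤ) ∧ (g : ℤ) < |w (i : ℤ)|) :=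
  exists_pair_congr fun i j _ hi _ hj => by
    rw [e hi, e hj, abs_up, ← up_neg, up_lt_up, succ_lt_up]

lemma pair_desc_neg_succ_lt_up (e : ∀ {i : ℕ}, i ≤ n → w' (i : ℤ) = up g (w (i : ℤ))) :
    (∃ i j : ℕ, 1 ≤ i ∧ i < j ∧ j ≤ n ∧ w' (j : ℤ) < |w' (i : ℤ)| ∧ -(g + 1 : ℤ) < w' (j : ℤ)) ↔
      (∃ i j : ℕ, 1 ≤ i ∧ i < j ∧ j ≤ n ∧ w (j : ℤ) < |w (i : ℤ)| ∧ -(g : ℤ) ≤ w (j : ℤ)) :=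
  exists_pair_congr fun i j _ hi _ hj => by
    rw [e hi, e hj, abs_up, up_lt_up, neg_succ_lt_up]

lemma pair_neg_big_neg_succ_lt_up (e : ∀ {i : ℕ}, i ≤ n → w' (i : ℤ) = up g (w (i : ℤ))) :
    (∃ i j : ℕ, 1 ≤ i ∧ i < j ∧ j ≤ n ∧ |w' (i : ℤ)| < -w' (j : ℤ) ∧ -(g + 1 : ℤ) < |w' (i : ℤ)|) ↔
      (∃ i j : ℕ, 1 ≤ i ∧ i < j ∧ j ≤ n ∧ |w (i : ℤ)| < -w (j : ℤ)) :=
  exists_pair_congr fun i j _ hi _ hj => by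
    rw [e hi, e hj, abs_up, ← up_neg, up_lt_up, neg_succ_lt_up, and_iff_left (by have := abs_nonneg (w (i : ℤ)); omega)]

lemma pair_desc_lt_up {g' : ℕ} (e : ∀ {i : ℕ}, i ≤ n → w' (i : ℤ) = up g (w (i : ℤ))) :
    (∃ i j : ℕ, 1 ≤ i ∧ i < j ∧ j ≤ n ∧ w' (j : ℤ) < |w' (i : ℤ)| ∧ (g' : ℤ) < w' (j : ℤ)) ↔
      (∃ i j : ℕ, 1 ≤ i ∧ i < j ∧ j ≤ n ∧ w (j : ℤ) < |w (i : ℤ)| ∧ (down g g' : ℤ) < w (j : ℤ)) :=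
  exists_pair_congr fun i j _ hi _ hj => by
    rw [e hi, e hj, abs_up, up_lt_up, lt_up]

lemma pair_neg_big_lt_up {g' : ℕ} (e : ∀ {i : ℕ}, i ≤ n → w' (i : ℤ) = up g (w (i : ℤ))) :
    (∃ i j : ℕ, 1 ≤ i ∧ i < j ∧ j ≤ n ∧ |w' (i : ℤ)| < -w' (j : ℤ) ∧ (g' : ℤ) < |w' (i : ℤ)|) ↔
      (∃ i j : ℕ, 1 ≤ i ∧ i < j ∧ j ≤ n ∧ |w (i : ℤ)| < -w (j : ℤ) ∧ (down g g' : ℤ) < |w (i : ℤ)|) :=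
  exists_pair_congr fun i j _ hi _ hj => by
    rw [e hi, e hj, abs_up, ← up_neg, up_lt_up, lt_up]

lemma pair_desc_neg_le_up {g' : ℕ} (e : ∀ {i : ℕ}, i ≤ n → w' (i : ℤ) = up g (w (i : ℤ))) :
    (∃ i j : ℕ, 1 ≤ i ∧ i < j ∧ j ≤ n ∧ w' (j : ℤ) < |w' (i : ℤ)| ∧ -(g' : ℤ) ≤ w' (j : ℤ)) ↔
      (∃ i j : ℕ, 1 ≤ i ∧ i < j ∧ j ≤ n ∧ w (j : ℤ) < |w (i : ℤ)| ∧ -(down g g' : ℤ) ≤ w (j : ℤ)) :=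
  exists_pair_congr fun i j _ hi _ hj => by
    rw [e hi, e hj, abs_up, up_lt_up, neg_le_up]

lemma pair_neg_big_up (e : ∀ {i : ℕ}, i ≤ n → w' (i : ℤ) = up g (w (i : ℤ))) :
    (∃ i j : ℕ, 1 ≤ i ∧ i < j ∧ j ≤ n ∧ |w' (i : ℤ)| < -w' (j : ℤ)) ↔
      (∃ i j : ℕ, 1 ≤ i ∧ i < j ∧ j ≤ n ∧ |w (i : ℤ)| < -w (j : ℤ)) :=
  exists_pair_congr fun i j _ hi _ hj => by
    rw [e hi, e hj, abs_up, ← up_neg, up_lt_up]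

end

lemma isFC_insP_iff (hw : InB n w) (hg : g ≤ n) :
    IsFC (n + 1) (insP n g w) ↔ IsFC n w ∧ ¬ BadP n w g := by
  have e : ∀ {i : ℕ}, i ≤ n → insP n g w i = up g (w i) := insP_natCast hw hg
  simp only [IsFC, BadP, hw, hw.insP hg, true_and, exists_pair_succ, exists_triple_succ,
    insP_succ hw hg]
  rw [pair_neg_desc_up e, triple_desc_desc_up e, triple_neg_big_up e, pair_desc_succ_lt_up e,
    pair_neg_big_succ_lt_up e]
  have h : ¬ ∃ i : ℕ, 1 ≤ i ∧ i ≤ n ∧ (g + 1 : ℤ) < insP n g w i ∧ insP n g w i < 0 := by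
    rintro ⟨i, -, -, h1, h2⟩
    omega
  simp only [h, or_false]
  exact (by tauto : ∀ p a b c d : Prop, (¬ p ∧ ¬ (a ∨ b) ∧ ¬ (c ∨ d)) ↔
    (¬ p ∧ ¬ a ∧ ¬ c) ∧ ¬ (b ∨ d)) _ _ _ _ _

lemma isFC_insN_iff (hw : InB n w) (hg : g ≤ n) :
    IsFC (n + 1) (insN n g w) ↔ IsFC n w ∧ ¬ BadN n w g := by
  have e : ∀ {i : ℕ}, i ≤ n → insN n g w i = up g (w i) := insN_natCast hw hg
  simp only [IsFC, BadN, hw, hw.insN hg, true_and, exists_pair_succ, exists_triple_succ,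
    insN_succ hw hg]
  rw [pair_neg_desc_up e, triple_desc_desc_up e, triple_neg_big_up e, pair_desc_neg_succ_lt_up e,
    pair_neg_big_neg_succ_lt_up e]
  have h : (∃ i : ℕ, 1 ≤ i ∧ i ≤ n ∧ -(g + 1 : ℤ) < insN n g w i ∧ insN n g w i < 0) ↔
      ∃ i : ℕ, 1 ≤ i ∧ i ≤ n ∧ -(g : ℤ) ≤ w i ∧ w i < 0 := exists_congr_Icc fun i _ hi => by
    rw [e hi, neg_succ_lt_up, up_lt_zero]
  rw [h]
  exact (by intros; simp only [not_or]; grind : ∀ a b c d e f : Prop, (¬ (a ∨ b) ∧ ¬ (c ∨ d) ∧ ¬ (e ∨ f)) ↔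
    (¬ a ∧ ¬ c ∧ ¬ e) ∧ ¬ (b ∨ d ∨ f)) _ _ _ _ _ _

lemma badP_insP_iff (hw : InB n w) (hg : g ≤ n) {g' : ℕ} :
    BadP (n + 1) (insP n g w) g' ↔ BadP n w (down g g') ∨ (g < n ∧ g' ≤ g) := by
  have e : ∀ {i : ℕ}, i ≤ n → insP n g w i = up g (w i) := insP_natCast hw hg
  simp only [BadP, exists_pair_succ, insP_succ hw hg]
  rw [pair_desc_lt_up e, pair_neg_big_lt_up e]
  have h1 : (∃ i : ℕ, 1 ≤ i ∧ i ≤ n ∧ (g + 1 : ℤ) < |insP n g w i| ∧ (g' : ℤ) < g + 1) ↔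
      g < n ∧ g' ≤ g := by
    constructor
    · rintro ⟨i, -, hi, h1, h2⟩
      have := hw.abs_apply_le (natCast_abs_le hi)
      rw [e hi, abs_up, succ_lt_up] at h1
      omega
    · rintro ⟨h1, h2⟩
      obtain ⟨i, hi, hi', h⟩ := hw.exists_abs_eq (a := n) (by omega) le_rfl
      refine ⟨i, hi, hi', ?_, by omega⟩
      rw [e hi', abs_up, succ_lt_up]
      omega
  have h2 : ¬ ∃ i : ℕ, 1 ≤ i ∧ i ≤ n ∧ |insP n g w i| < -(g + 1 : ℤ) ∧
      (g' : ℤ) < |insP n g w i| := by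
    rintro ⟨i, -, -, h1, h2⟩
    omega
  simp only [h1, h2, or_false]
  exact or_right_comm

lemma badN_insP_iff (hw : InB n w) (hg : g ≤ n) {g' : ℕ} :
    BadN (n + 1) (insP n g w) g' ↔ BadN n w (down g g') ∨ g < n := by
  have e : ∀ {i : ℕ}, i ≤ n → insP n g w i = up g (w i) := insP_natCast hw hg
  simp only [BadN, exists_pair_succ, insP_succ hw hg]
  have h1 : (∃ i : ℕ, 1 ≤ i ∧ i ≤ n + 1 ∧ -(g' : ℤ) ≤ insP n g w i ∧ insP n g w i < 0) ↔
      ∃ i : ℕ, 1 ≤ i ∧ i ≤ n ∧ -(down g g' : ℤ) ≤ w i ∧ w i < 0 := by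
    constructor
    · rintro ⟨i, hi, hi', h⟩
      rcases Nat.lt_or_ge n i with h4 | h4
      · obtain rfl : i = n + 1 := by omega
        rw [insP_succ hw hg] at h; omega
      · rw [e h4, neg_le_up, up_lt_zero] at h
        exact ⟨i, hi, h4, h⟩
    · rintro ⟨i, hi, hi', h⟩
      refine ⟨i, hi, by omega, ?_⟩
      rwa [e hi', neg_le_up, up_lt_zero]
  have h2 : (∃ i : ℕ, 1 ≤ i ∧ i ≤ n ∧ (g + 1 : ℤ) < |insP n g w i| ∧ -(g' : ℤ) ≤ g + 1) ↔
      g < n := by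
    constructor
    · rintro ⟨i, -, hi, h1, h2⟩
      have := hw.abs_apply_le (natCast_abs_le hi)
      rw [e hi, abs_up, succ_lt_up] at h1
      omega
    · intro h1
      obtain ⟨i, hi, hi', h⟩ := hw.exists_abs_eq (a := n) (by omega) le_rfl
      refine ⟨i, hi, hi', ?_, by omega⟩
      rw [e hi', abs_up, succ_lt_up]
      omega
  have h3 : ¬ ∃ i : ℕ, 1 ≤ i ∧ i ≤ n ∧ |insP n g w i| < -(g + 1 : ℤ) := by
    rintro ⟨i, -, -, h⟩
    have := abs_nonneg (insP n g w i)
    omega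
  rw [h1, h2, pair_desc_neg_le_up e, pair_neg_big_up e]
  simp only [h3, or_false]
  exact (by tauto : ∀ a b c d : Prop, a ∨ (b ∨ c) ∨ d ↔ (a ∨ b ∨ d) ∨ c) _ _ _ _

lemma badP_insN_iff (hw : InB n w) (hg : g ≤ n) {g' : ℕ} :
    BadP (n + 1) (insN n g w) g' ↔ BadP n w (down g g') ∨ g' < g := by
  have e : ∀ {i : ℕ}, i ≤ n → insN n g w i = up g (w i) := insN_natCast hw hg
  simp only [BadP, exists_pair_succ, insN_succ hw hg]
  have h2 : (∃ i : ℕ, 1 ≤ i ∧ i ≤ n ∧ |insN n g w i| < - -(g + 1 : ℤ) ∧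
      (g' : ℤ) < |insN n g w i|) ↔ g' < g := by
    constructor
    · rintro ⟨i, -, hi, h1, h2⟩
      rw [e hi, abs_up] at h1 h2
      unfold up at h1 h2
      split_ifs at h1 h2 <;> omega
    · intro h1
      obtain ⟨i, hi, hi', h⟩ := hw.exists_abs_eq (a := g) (by omega) hg
      refine ⟨i, hi, hi', ?_⟩
      rw [e hi', abs_up, h]
      unfold up
      split_ifs <;> omega
  have h3 : ¬ ∃ i : ℕ, 1 ≤ i ∧ i ≤ n ∧ -(g + 1 : ℤ) < |insN n g w i| ∧
      (g' : ℤ) < -(g + 1) := by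
    rintro ⟨i, -, -, -, h⟩
    omega
  rw [h2, pair_desc_lt_up e, pair_neg_big_lt_up e]
  simp only [h3, or_false]
  exact or_assoc.symm

lemma badN_insN_iff (hw : InB n w) (hg : g ≤ n) {g' : ℕ} :
    BadN (n + 1) (insN n g w) g' ↔ BadN n w (down g g') ∨ g + 1 ≤ g' ∨ 1 ≤ g := by
  have e : ∀ {i : ℕ}, i ≤ n → insN n g w i = up g (w i) := insN_natCast hw hg
  simp only [BadN, exists_pair_succ, insN_succ hw hg]
  have h1 : (∃ i : ℕ, 1 ≤ i ∧ i ≤ n + 1 ∧ -(g' : ℤ) ≤ insN n g w i ∧ insN n g w i < 0) ↔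
      (∃ i : ℕ, 1 ≤ i ∧ i ≤ n ∧ -(down g g' : ℤ) ≤ w i ∧ w i < 0) ∨ g + 1 ≤ g' := by
    constructor
    · rintro ⟨i, hi, hi', h⟩
      rcases Nat.lt_or_ge n i with h4 | h4
      · obtain rfl : i = n + 1 := by omega
        rw [insN_succ hw hg] at h
        exact Or.inr (by omega)
      · rw [e h4, neg_le_up, up_lt_zero] at h
        exact Or.inl ⟨i, hi, h4, h⟩
    · rintro (⟨i, hi, hi', h⟩ | h)
      · refine ⟨i, hi, by omega, ?_⟩
        rwa [e hi', neg_le_up, up_lt_zero]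
      · refine ⟨n + 1, by omega, le_rfl, ?_⟩
        rw [insN_succ hw hg]; omega
  have h2 : (∃ i : ℕ, 1 ≤ i ∧ i ≤ n ∧ |insN n g w i| < - -(g + 1 : ℤ)) ↔ 1 ≤ g := by
    constructor
    · rintro ⟨i, hi, hi', h1⟩
      have := hw.apply_ne_zero (i := i) (by omega)
      have := abs_pos.2 this
      rw [e hi', abs_up] at h1
      unfold up at h1
      split_ifs at h1 <;> omega
    · intro h1
      obtain ⟨i, hi, hi', h⟩ := hw.exists_abs_eq h1 hg
      refine ⟨i, hi, hi', ?_⟩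
      rw [e hi', abs_up, h]
      unfold up
      split_ifs <;> omega
  have h3 : (∃ i : ℕ, 1 ≤ i ∧ i ≤ n ∧ -(g + 1 : ℤ) < |insN n g w i| ∧
      -(g' : ℤ) ≤ -(g + 1)) → g + 1 ≤ g' := by
    rintro ⟨i, -, -, -, h⟩
    omega
  rw [h1, h2, pair_desc_neg_le_up e, pair_neg_big_up e]
  exact (by intros; grind : ∀ a b c d e f : Prop, (f → e) → ((a ∨ e) ∨ (b ∨ f) ∨ (c ∨ d) ↔
    (a ∨ b ∨ c) ∨ e ∨ d)) _ _ _ _ _ _ h3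

end Patterns

section Statistics

variable {n g : ℕ} {w : Equiv.Perm ℤ} {A : ℕ → Prop}

lemma up_zero {g : ℕ} : up g 0 = 0 := by
  unfold up; split_ifs <;> omega

lemma went_insP (hw : InB n w) (hg : g ≤ n) {i : ℕ} (hi : i ≤ n) :
    went (insP n g w) i = up g (went w i) := by
  unfold went
  split_ifs
  · exact up_zero.symm
  · exact insP_natCast hw hg hi

lemma went_insN (hw : InB n w) (hg : g ≤ n) {i : ℕ} (hi : i ≤ n) :
    went (insN n g w) i = up g (went w i) := by
  unfold went
  split_ifs
  · exact up_zero.symm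
  · exact insN_natCast hw hg hi

lemma went_insP_succ (hw : InB n w) (hg : g ≤ n) : went (insP n g w) (n + 1) = g + 1 := by
  rw [went, if_neg (by omega), insP_succ hw hg]

lemma went_insN_succ (hw : InB n w) (hg : g ≤ n) : went (insN n g w) (n + 1) = -(g + 1) := by
  rw [went, if_neg (by omega), insN_succ hw hg]

lemma went_le (hw : InB n w) : went w n ≤ n := by
  unfold went
  split_ifs
  · omega
  · exact (abs_le.1 (hw.abs_apply_le (natCast_abs_le le_rfl))).2

/-- All type-B descents of `w` satisfy `A`. -/
def DesOK (A : ℕ → Prop) (n : ℕ) (w : Equiv.Perm ℤ) : Prop := ∀ j ∈ DesB n w, A j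

lemma desOK_iff : DesOK A n w ↔ ∀ j < n, went w (j + 1) < went w j → A j := by
  simp [DesOK, DesB]

lemma desOK_insP_iff (hw : InB n w) (hg : g ≤ n) :
    DesOK A (n + 1) (insP n g w) ↔ DesOK A n w ∧ (g < went w n → A n) := by
  rw [desOK_iff, desOK_iff, Nat.forall_lt_succ_right, went_insP_succ hw hg,
    went_insP hw hg le_rfl, succ_lt_up]
  refine and_congr_left' (forall₂_congr fun j hj => ?_)
  rw [went_insP hw hg hj, went_insP hw hg hj.le, up_lt_up]

lemma desOK_insN_iff (hw : InB n w) (hg : g ≤ n) :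
    DesOK A (n + 1) (insN n g w) ↔ DesOK A n w ∧ (-(g : ℤ) ≤ went w n → A n) := by
  rw [desOK_iff, desOK_iff, Nat.forall_lt_succ_right, went_insN_succ hw hg,
    went_insN hw hg le_rfl, neg_succ_lt_up]
  refine and_congr_left' (forall₂_congr fun j hj => ?_)
  rw [went_insN hw hg hj, went_insN hw hg hj.le, up_lt_up]

lemma negSet_nonempty_iff :
    (NegSet n w).Nonempty ↔ ∃ i : ℕ, 1 ≤ i ∧ i ≤ n ∧ w (i : ℤ) < 0 := by
  simp [NegSet, Finset.Nonempty, and_assoc]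

lemma negSet_insP_nonempty_iff (hw : InB n w) (hg : g ≤ n) :
    (NegSet (n + 1) (insP n g w)).Nonempty ↔ (NegSet n w).Nonempty := by
  rw [negSet_nonempty_iff, negSet_nonempty_iff]
  constructor
  · rintro ⟨i, h1, h2, h⟩
    rcases Nat.lt_or_ge n i with h4 | h4
    · obtain rfl : i = n + 1 := by omega
      rw [insP_succ hw hg] at h; omega
    · rw [insP_natCast hw hg h4, up_lt_zero] at h
      exact ⟨i, h1, h4, h⟩
  · rintro ⟨i, h1, h2, h⟩
    exact ⟨i, h1, by omega, by rwa [insP_natCast hw hg h2, up_lt_zero]⟩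

lemma negSet_insN_nonempty (hw : InB n w) (hg : g ≤ n) :
    (NegSet (n + 1) (insN n g w)).Nonempty :=
  negSet_nonempty_iff.2 ⟨n + 1, by omega, le_rfl, by rw [insN_succ hw hg]; omega⟩

lemma InB.abs_inv_le (hw : InB n w) {j : ℕ} (hj : j ≤ n) : |w⁻¹ (j : ℤ)| ≤ n :=
  hw.inv.abs_apply_le (natCast_abs_le hj)

lemma insP_inv (hw : InB n w) (hg : g ≤ n) {j : ℕ} (hj : j ≤ n) :
    (insP n g w)⁻¹ ((if j ≤ g then j else j + 1 : ℕ) : ℤ) = w⁻¹ (j : ℤ) := by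
  rw [Equiv.Perm.inv_eq_iff_eq, insP_apply hw hg (hw.abs_inv_le hj), show w (w⁻¹ (j : ℤ)) = j from w.apply_symm_apply _, up]
  split_ifs <;> omega

lemma insN_inv (hw : InB n w) (hg : g ≤ n) {j : ℕ} (hj : j ≤ n) :
    (insN n g w)⁻¹ ((if j ≤ g then j else j + 1 : ℕ) : ℤ) = w⁻¹ (j : ℤ) := by
  rw [Equiv.Perm.inv_eq_iff_eq, insN_apply hw hg (hw.abs_inv_le hj), show w (w⁻¹ (j : ℤ)) = j from w.apply_symm_apply _, up]
  split_ifs <;> omega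

lemma insP_inv_succ (hw : InB n w) (hg : g ≤ n) :
    (insP n g w)⁻¹ ((g + 1 : ℕ) : ℤ) = n + 1 := by
  rw [Equiv.Perm.inv_eq_iff_eq, insP_last hw hg]; norm_cast

lemma insN_inv_succ (hw : InB n w) (hg : g ≤ n) :
    (insN n g w)⁻¹ ((g + 1 : ℕ) : ℤ) = -(n + 1) := by
  rw [Equiv.Perm.inv_eq_iff_eq, (hw.insN hg).1, insN_last hw hg]; push_cast; ring

/-- In `w⁻¹`, all of the first `p` entries are smaller than all the other ones. -/
def Cut (n : ℕ) (w : Equiv.Perm ℤ) (p : ℕ) : Prop :=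
  ∀ j ∈ Finset.Icc 1 p, ∀ k ∈ Finset.Icc (p + 1) n, w⁻¹ (j : ℤ) < w⁻¹ (k : ℤ)

lemma cut_of_le {p : ℕ} (h : n ≤ p) : Cut n w p := fun j _ k hk => by
  rw [Finset.mem_Icc] at hk; omega

lemma cut_zero : Cut n w 0 := fun j hj => by
  rw [Finset.mem_Icc] at hj; omega

lemma exists_index {g j : ℕ} (hj : j ≠ g + 1) :
    ∃ i, j = if i ≤ g then i else i + 1 := by
  rcases le_or_gt j g with h | h
  · exact ⟨j, by rw [if_pos h]⟩
  · exact ⟨j - 1, by rw [if_neg (by omega)]; omega⟩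

lemma cut_insP_iff (hw : InB n w) (hg : g ≤ n) {p : ℕ} (hp : 1 ≤ p) (hpn : p ≤ n + 1) :
    Cut (n + 1) (insP n g w) p ↔ (p ≤ g ∧ Cut n w p) ∨ p = n + 1 := by
  rcases eq_or_ne p (n + 1) with rfl | hne
  · simp [cut_of_le le_rfl]
  simp only [hne, or_false]
  constructor
  · intro h
    have hpg : p ≤ g := by
      by_contra hlt
      have h1 := h (g + 1) (Finset.mem_Icc.2 (by omega)) (if n ≤ g then n else n + 1)
        (Finset.mem_Icc.2 (by split_ifs <;> omega))
      rw [insP_inv_succ hw hg, insP_inv hw hg le_rfl] at h1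
      have := (abs_le.1 (hw.abs_inv_le (le_refl n))).2
      omega
    refine ⟨hpg, fun j hj k hk => ?_⟩
    rw [Finset.mem_Icc] at hj hk
    rw [← insP_inv hw hg (show j ≤ n by omega), ← insP_inv hw hg hk.2]
    refine h _ (Finset.mem_Icc.2 ?_) _ (Finset.mem_Icc.2 ?_) <;> split_ifs <;> omega
  · rintro ⟨hpg, h⟩ j hj k hk
    rw [Finset.mem_Icc] at hj hk
    obtain ⟨j, rfl⟩ := exists_index (show j ≠ g + 1 by omega)
    have hj' : 1 ≤ j ∧ j ≤ p := by revert hj; split_ifs <;> omega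
    rw [insP_inv hw hg (by omega)]
    rcases eq_or_ne k (g + 1) with rfl | hk'
    · rw [insP_inv_succ hw hg]
      have := (abs_le.1 (hw.abs_inv_le (show j ≤ n by omega))).2
      omega
    · obtain ⟨k, rfl⟩ := exists_index hk'
      have hk' : p + 1 ≤ k ∧ k ≤ n := by revert hk; split_ifs <;> omega
      rw [insP_inv hw hg hk'.2]
      exact h j (Finset.mem_Icc.2 hj') k (Finset.mem_Icc.2 hk')

lemma cut_insN_iff (hw : InB n w) (hg : g ≤ n) {p : ℕ} (hp : 1 ≤ p) :
    Cut (n + 1) (insN n g w) p ↔ g + 1 ≤ p ∧ Cut n w (p - 1) := by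
  constructor
  · intro h
    have hpg : g + 1 ≤ p := by
      by_contra hlt
      have h1 := h (if 1 ≤ g then 1 else 1 + 1) (Finset.mem_Icc.2 (by split_ifs <;> omega)) (g + 1)
        (Finset.mem_Icc.2 (by omega))
      rw [insN_inv_succ hw hg, insN_inv hw hg (by omega)] at h1
      have := (abs_le.1 (hw.abs_inv_le (show 1 ≤ n by omega))).1
      push_cast at *
      omega
    refine ⟨hpg, fun j hj k hk => ?_⟩
    rw [Finset.mem_Icc] at hj hk
    rw [← insN_inv hw hg (show j ≤ n by omega), ← insN_inv hw hg hk.2]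
    refine h _ (Finset.mem_Icc.2 ?_) _ (Finset.mem_Icc.2 ?_) <;> split_ifs <;> omega
  · rintro ⟨hpg, h⟩ j hj k hk
    rw [Finset.mem_Icc] at hj hk
    obtain ⟨k, rfl⟩ := exists_index (show k ≠ g + 1 by omega)
    have hk' : p - 1 + 1 ≤ k ∧ k ≤ n := by revert hk; split_ifs <;> omega
    rw [insN_inv hw hg hk'.2]
    rcases eq_or_ne j (g + 1) with rfl | hj'
    · rw [insN_inv_succ hw hg]
      have := (abs_le.1 (hw.abs_inv_le hk'.2)).1
      omega
    · obtain ⟨j, rfl⟩ := exists_index hj'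
      have hj' : 1 ≤ j ∧ j ≤ p - 1 := by revert hj; split_ifs <;> omega
      rw [insN_inv hw hg (by omega)]
      exact h j (Finset.mem_Icc.2 hj') k (Finset.mem_Icc.2 hk')

lemma bl_inv (hn : 1 ≤ n) : bl n w⁻¹ = ((Finset.Icc 1 n).filter (Cut n w)).card := by
  rw [← Finset.Ico_insert_right hn, Finset.filter_insert, if_pos (cut_of_le le_rfl),
    Finset.card_insert_of_notMem (by simp), bl, add_comm,
    show Finset.Ico 1 n = Finset.Ioo 0 n from rfl]
  congr 2
  ext p
  simp [Cut]

end Statistics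

section Sums

variable {R : Type*} [CommRing R]

lemma one_sub_mul_sum_pow (q : R) {t s : ℕ} (h : t ≤ s) :
    (1 - q) * ∑ i ∈ Finset.Ico t s, q ^ i = q ^ t - q ^ s := by
  induction s, h using Nat.le_induction with
  | base => simp
  | succ s h ih => rw [Finset.sum_Ico_succ_top h, mul_add, ih]; ring

lemma sum_pow_mul_eq (q : R) (f : ℕ → R) {t s : ℕ} (h : t ≤ s) :
    ∑ i ∈ Finset.Icc 1 s, q ^ (t - i) * (f i + (1 - q) * ∑ j ∈ Finset.Ico 1 i, f j) =
      ∑ i ∈ Finset.Icc 1 s, f i +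
        (1 - q) * ∑ i ∈ Finset.Ico t s, ∑ j ∈ Finset.Icc 1 i, f j := by
  have hIco : ∀ m, Finset.Ico 1 (m + 1) = Finset.Icc 1 m := fun m => rfl
  induction s, h using Nat.le_induction with
  | base =>
    rw [Finset.Ico_self, Finset.sum_empty, mul_zero, add_zero]
    induction t with
    | zero => simp
    | succ t ih =>
      rw [Finset.sum_Icc_succ_top (by omega), Finset.sum_Icc_succ_top (by omega), hIco]
      have : ∀ i ∈ Finset.Icc 1 t,
          q ^ (t + 1 - i) * (f i + (1 - q) * ∑ j ∈ Finset.Ico 1 i, f j) =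
            q * (q ^ (t - i) * (f i + (1 - q) * ∑ j ∈ Finset.Ico 1 i, f j)) := fun i hi => by
        rw [Finset.mem_Icc] at hi
        rw [show t + 1 - i = t - i + 1 by omega]
        ring
      rw [Finset.sum_congr rfl this, ← Finset.mul_sum, ih, Nat.sub_self]
      ring
  | succ s h ih =>
    rw [Finset.sum_Icc_succ_top (by omega), Finset.sum_Icc_succ_top (by omega), ih, hIco,
      Finset.sum_Ico_succ_top h, show t - (s + 1) = 0 by omega]
    ring

lemma sum_range_eq_sum_Icc_sub {n M s : ℕ} (hn : n = M + s) {a : ℕ → R}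
    (h : ∀ g < M, a g = 0) : ∑ g ∈ Finset.range n, a g = ∑ i ∈ Finset.Icc 1 s, a (n - i) := by
  have hsub : Finset.Ico M n ⊆ Finset.range n := fun g hg => by
    rw [Finset.mem_Ico] at hg; rw [Finset.mem_range]; omega
  rw [← Finset.sum_subset hsub fun g hg hg' => h g (by
    rw [Finset.mem_Ico] at hg'; rw [Finset.mem_range] at hg; omega)]
  refine Finset.sum_nbij' (n - ·) (n - ·) ?_ ?_ ?_ ?_ ?_
  all_goals intro i hi; simp only [Finset.mem_Ico, Finset.mem_Icc] at *
  all_goals first | omega | (congr 1; omega)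

end Sums

section States

variable {R : Type*} [CommRing R] (q : R) (A : ℕ → Prop)

/-- The sum of `q ^ bl (v⁻¹)` over the fully commutative signed permutations `v` of size `n + r`
with a negative entry and all descents satisfying `A` which are obtained from `w` by inserting `r`
last entries. -/
def insSum : ℕ → ℕ → Equiv.Perm ℤ → R
  | 0, n, w => if IsFC n w ∧ (NegSet n w).Nonempty ∧ DesOK A n w then
      q ^ ((Finset.Icc 1 n).filter (Cut n w)).card else 0
  | r + 1, n, w => ∑ g ∈ Finset.range (n + 1),
      (insSum r (n + 1) (insP n g w) + insSum r (n + 1) (insN n g w))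

lemma sum_insSum (r n : ℕ) :
    ∑ w ∈ signedPerms n, insSum q A r n w = ∑ w ∈ signedPerms (n + r), insSum q A 0 (n + r) w := by
  induction r generalizing n with
  | zero => rfl
  | succ r ih =>
    rw [show n + (r + 1) = n + 1 + r by omega, ← ih, sum_signedPerms_succ]
    rfl

variable {n g : ℕ} {w : Equiv.Perm ℤ} {l : Bool}

variable {A}

lemma insSum_eq_zero (hw : InB n w) (h : ¬ (IsFC n w ∧ DesOK A n w)) (r : ℕ) :
    insSum q A r n w = 0 := by
  induction r generalizing n w with
  | zero => exact if_neg (by tauto)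
  | succ r ih =>
    refine Finset.sum_eq_zero fun g hg => ?_
    have hg : g ≤ n := Nat.lt_succ_iff.1 (Finset.mem_range.1 hg)
    rw [ih (hw.insP hg), ih (hw.insN hg), add_zero]
    · rw [isFC_insN_iff hw hg, desOK_insN_iff hw hg]; tauto
    · rw [isFC_insP_iff hw hg, desOK_insP_iff hw hg]; tauto

lemma insSum_insP_eq_zero (hw : InB n w) (hg : g ≤ n) (h : BadP n w g) (r : ℕ) :
    insSum q A r (n + 1) (insP n g w) = 0 :=
  insSum_eq_zero q (hw.insP hg) (by rw [isFC_insP_iff hw hg]; tauto) r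

lemma insSum_insN_eq_zero (hw : InB n w) (hg : g ≤ n) (h : BadN n w g) (r : ℕ) :
    insSum q A r (n + 1) (insN n g w) = 0 :=
  insSum_eq_zero q (hw.insN hg) (by rw [isFC_insN_iff hw hg]; tauto) r

lemma insSum_eq_zero_of_badN (hw : InB n w) (h : ¬ (NegSet n w).Nonempty)
    (hb : ∀ g ≤ n, BadN n w g) (r : ℕ) : insSum q A r n w = 0 := by
  induction r generalizing n w with
  | zero => exact if_neg (by tauto)
  | succ r ih =>
    refine Finset.sum_eq_zero fun g hg => ?_
    have hg : g ≤ n := Nat.lt_succ_iff.1 (Finset.mem_range.1 hg)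
    rw [insSum_insN_eq_zero q hw hg (hb g hg), add_zero]
    refine ih (hw.insP hg) (by rwa [negSet_insP_nonempty_iff hw hg]) fun g' hg' => ?_
    rw [badN_insP_iff hw hg]
    exact Or.inl (hb _ (by unfold down; split_ifs <;> omega))

/-- Every entry of `w` is larger in absolute value than all previous ones if it is positive, and
smaller if it is negative; the last entry is positive if and only if `l = true`. -/
structure IsFree (n : ℕ) (w : Equiv.Perm ℤ) (l : Bool) : Prop where
  fc : IsFC n w
  neg : (NegSet n w).Nonempty
  badP : ∀ g ≤ n, ¬ BadP n w g
  badN : ∀ g ≤ n, (BadN n w g ↔ 1 ≤ g)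
  cut : ∀ p, 1 ≤ p → p ≤ n → Cut n w p
  last : if l = true then went w n = n else went w n < 0

/-- Only the insertions of `g + 1` for `M ≤ g` preserve full commutativity of `w`, and the
statistics relevant for these insertions are described by `s`, `t`, `b` and `l`. -/
structure IsStuck (n : ℕ) (w : Equiv.Perm ℤ) (M s t b : ℕ) (l : Bool) : Prop where
  fc : IsFC n w
  neg : (NegSet n w).Nonempty
  size : n = M + s
  one_le : 1 ≤ t
  le : t ≤ s
  badP : ∀ g ≤ n, (BadP n w g ↔ g < M)
  badN : ∀ g ≤ n, BadN n w g
  cut : ∀ p, M < p → p ≤ n → (Cut n w p ↔ n < p + t)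
  card : ((Finset.Icc 1 M).filter (Cut n w)).card = b
  last : if l = true then went w n = n else went w n ≤ M

lemma IsFC.inB (h : IsFC n w) : InB n w := h.1

lemma IsFree.pos (h : IsFree n w l) : 1 ≤ n := by
  obtain ⟨i, hi⟩ := negSet_nonempty_iff.1 h.neg
  omega

lemma IsFree.insP_self (h : IsFree n w l) : IsFree (n + 1) (insP n n w) true := by
  have hw := h.fc.inB
  have hn := h.pos
  refine ⟨(isFC_insP_iff hw le_rfl).2 ⟨h.fc, h.badP n le_rfl⟩,
    (negSet_insP_nonempty_iff hw le_rfl).2 h.neg, fun g hg => ?_, fun g hg => ?_,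
    fun p hp hpn => ?_, ?_⟩
  · have hd : down n g ≤ n := by unfold down; split_ifs <;> omega
    rw [badP_insP_iff hw le_rfl]
    simpa using h.badP _ hd
  · have hd : down n g ≤ n ∧ (1 ≤ down n g ↔ 1 ≤ g) := by unfold down; split_ifs <;> omega
    rw [badN_insP_iff hw le_rfl, h.badN _ hd.1, hd.2]
    simp
  · rw [cut_insP_iff hw le_rfl hp hpn]
    rcases Nat.lt_or_ge n p with h1 | h1
    · exact Or.inr (by omega)
    · exact Or.inl ⟨h1, h.cut p hp h1⟩
  · rw [if_pos rfl, went_insP_succ hw le_rfl]; push_cast; ring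

lemma IsFree.insN_zero (h : IsFree n w l) : IsFree (n + 1) (insN n 0 w) false := by
  have hw := h.fc.inB
  have h0 : 0 ≤ n := by omega
  refine ⟨(isFC_insN_iff hw h0).2 ⟨h.fc, by rw [h.badN 0 h0]; omega⟩,
    negSet_insN_nonempty hw h0, fun g hg => ?_, fun g hg => ?_, fun p hp hpn => ?_, ?_⟩
  · have hd : down 0 g ≤ n := by unfold down; split_ifs <;> omega
    rw [badP_insN_iff hw h0]
    simpa using h.badP _ hd
  · have hd : down 0 g ≤ n ∧ (1 ≤ down 0 g → 1 ≤ g) := by unfold down; split_ifs <;> omega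
    rw [badN_insN_iff hw h0, h.badN _ hd.1]
    omega
  · rw [cut_insN_iff hw h0 hp]
    refine ⟨by omega, ?_⟩
    rcases Nat.eq_or_lt_of_le hp with h1 | h1
    · rw [← h1]; exact cut_zero
    · exact h.cut _ (by omega) (by omega)
  · rw [if_neg (by simp), went_insN_succ hw h0]; simp

lemma IsFree.insP_lt (h : IsFree n w l) (hg : g < n) :
    IsStuck (n + 1) (insP n g w) (g + 1) (n - g) 1 g false := by
  have hw := h.fc.inB
  refine ⟨(isFC_insP_iff hw hg.le).2 ⟨h.fc, h.badP g hg.le⟩,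
    (negSet_insP_nonempty_iff hw hg.le).2 h.neg, by omega, le_rfl, by omega, fun g' hg' => ?_,
    fun g' hg' => ?_, fun p hp hpn => ?_, ?_, ?_⟩
  · have hd : down g g' ≤ n := by unfold down; split_ifs <;> omega
    rw [badP_insP_iff hw hg.le, iff_false_intro (h.badP _ hd), false_or]
    omega
  · exact (badN_insP_iff hw hg.le).2 (Or.inr hg)
  · rw [cut_insP_iff hw hg.le (by omega) hpn]
    omega
  · rw [show (Finset.Icc 1 (g + 1)).filter (Cut (n + 1) (insP n g w)) = Finset.Icc 1 g from ?_]
    · simp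
    · ext p
      rw [Finset.mem_filter, Finset.mem_Icc, Finset.mem_Icc]
      refine ⟨fun ⟨hp, hc⟩ => ?_, fun hp => ⟨by omega, ?_⟩⟩
      · rw [cut_insP_iff hw hg.le hp.1 (by omega)] at hc
        omega
      · rw [cut_insP_iff hw hg.le hp.1 (by omega)]
        exact Or.inl ⟨hp.2, h.cut p hp.1 (by omega)⟩
  · rw [if_neg (by simp), went_insP_succ hw hg.le]; push_cast; rfl

variable {M s t b : ℕ}

lemma IsStuck.insP_self (h : IsStuck n w M s t b l) :
    IsStuck (n + 1) (insP n n w) M (s + 1) (t + 1) b true := by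
  have hw := h.fc.inB
  have h1 := h.size
  have h2 := h.one_le
  have h3 := h.le
  refine ⟨(isFC_insP_iff hw le_rfl).2 ⟨h.fc, by rw [h.badP n le_rfl]; omega⟩,
    (negSet_insP_nonempty_iff hw le_rfl).2 h.neg, by omega, by omega, by omega, fun g hg => ?_,
    fun g hg => ?_, fun p hp hpn => ?_, ?_, ?_⟩
  · have hd : down n g ≤ n ∧ (down n g < M ↔ g < M) := by unfold down; split_ifs <;> omega
    rw [badP_insP_iff hw le_rfl, h.badP _ hd.1, hd.2]
    omega
  · have hd : down n g ≤ n := by unfold down; split_ifs <;> omega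
    exact (badN_insP_iff hw le_rfl).2 (Or.inl (h.badN _ hd))
  · rw [cut_insP_iff hw le_rfl (by omega) hpn]
    rcases Nat.lt_or_ge n p with h4 | h4
    · omega
    · rw [h.cut p hp h4]; omega
  · rw [← h.card]
    refine congrArg Finset.card (Finset.filter_congr fun p hp => ?_)
    rw [Finset.mem_Icc] at hp
    rw [cut_insP_iff hw le_rfl hp.1 (by omega)]
    exact ⟨fun h' => h'.elim And.right (by omega), fun h' => Or.inl ⟨by omega, h'⟩⟩
  · rw [if_pos rfl, went_insP_succ hw le_rfl]; push_cast; ring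

lemma IsStuck.insP_lt (h : IsStuck n w M s t b l) (hM : M ≤ g) (hg : g < n) :
    IsStuck (n + 1) (insP n g w) (g + 1) (n - g) 1 (b + (t - (n - g))) false := by
  have hw := h.fc.inB
  have h1 := h.size
  have h2 := h.one_le
  have h3 := h.le
  refine ⟨(isFC_insP_iff hw hg.le).2 ⟨h.fc, by rw [h.badP g hg.le]; omega⟩,
    (negSet_insP_nonempty_iff hw hg.le).2 h.neg, by omega, le_rfl, by omega, fun g' hg' => ?_,
    fun g' hg' => ?_, fun p hp hpn => ?_, ?_, ?_⟩
  · have hd : down g g' ≤ n ∧ (down g g' < M → g' < g + 1) := by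
      unfold down; split_ifs <;> omega
    rw [badP_insP_iff hw hg.le, h.badP _ hd.1]
    omega
  · exact (badN_insP_iff hw hg.le).2 (Or.inr hg)
  · rw [cut_insP_iff hw hg.le (by omega) hpn]
    omega
  · have hu : (Finset.Icc 1 (g + 1)).filter (Cut (n + 1) (insP n g w)) =
        (Finset.Icc 1 M).filter (Cut n w) ∪ Finset.Ioc (n - t) g := by
      ext p
      rw [Finset.mem_union, Finset.mem_filter, Finset.mem_filter, Finset.mem_Icc, Finset.mem_Icc,
        Finset.mem_Ioc]
      constructor
      · rintro ⟨hp, hc⟩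
        rw [cut_insP_iff hw hg.le hp.1 (by omega)] at hc
        obtain ⟨hpg, hc⟩ := hc.resolve_right (by omega)
        rcases Nat.lt_or_ge M p with h4 | h4
        · rw [h.cut p h4 (by omega)] at hc
          exact Or.inr (by omega)
        · exact Or.inl ⟨⟨hp.1, h4⟩, hc⟩
      · rintro (⟨hp, hc⟩ | hp)
        · refine ⟨by omega, (cut_insP_iff hw hg.le hp.1 (by omega)).2 (Or.inl ⟨by omega, hc⟩)⟩
        · refine ⟨by omega, (cut_insP_iff hw hg.le (by omega) (by omega)).2 (Or.inl ⟨hp.2, ?_⟩)⟩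
          rw [h.cut p (by omega) (by omega)]
          omega
    rw [hu, Finset.card_union_of_disjoint, h.card, Nat.card_Ioc]
    · omega
    · rw [Finset.disjoint_left]
      intro p hp hp'
      rw [Finset.mem_filter, Finset.mem_Icc] at hp
      rw [Finset.mem_Ioc] at hp'
      omega
  · rw [if_neg (by simp), went_insP_succ hw hg.le]; push_cast; rfl

lemma IsStuck.card_cut (h : IsStuck n w M s t b l) :
    ((Finset.Icc 1 n).filter (Cut n w)).card = b + t := by
  have h1 := h.size
  have h2 := h.one_le
  have h3 := h.le
  have hu : (Finset.Icc 1 n).filter (Cut n w) =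
      (Finset.Icc 1 M).filter (Cut n w) ∪ Finset.Ioc (n - t) n := by
    ext p
    rw [Finset.mem_union, Finset.mem_filter, Finset.mem_filter, Finset.mem_Icc, Finset.mem_Icc,
      Finset.mem_Ioc]
    rcases Nat.lt_or_ge M p with h4 | h4
    · constructor
      · rintro ⟨hp, hc⟩
        rw [h.cut p h4 hp.2] at hc
        omega
      · rintro (⟨hp, hc⟩ | hp)
        · omega
        · exact ⟨by omega, (h.cut p h4 hp.2).2 (by omega)⟩
    · constructor
      · rintro ⟨hp, hc⟩
        exact Or.inl ⟨by omega, hc⟩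
      · rintro (⟨hp, hc⟩ | hp)
        · exact ⟨by omega, hc⟩
        · omega
  rw [hu, Finset.card_union_of_disjoint, h.card, Nat.card_Ioc]
  · omega
  · rw [Finset.disjoint_left]
    intro p hp hp'
    rw [Finset.mem_filter, Finset.mem_Icc] at hp
    rw [Finset.mem_Ioc] at hp'
    omega

lemma insSum_stuck (r : ℕ) (h : IsStuck n w M s t b l) (hd : DesOK A n w) :
    insSum q A r n w =
      q ^ b * (psi q A r n l s + (1 - q) * ∑ i ∈ Finset.Ico t s, psi q A r n l i) := by
  induction r generalizing n w M s t b l with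
  | zero =>
    rw [insSum, if_pos ⟨h.fc, h.neg, hd⟩, h.card_cut]
    simp only [psi]
    rw [one_sub_mul_sum_pow q h.le]
    ring
  | succ r ih =>
    have hw := h.fc.inB
    have h1 := h.size
    have h2 := h.one_le
    have h3 := h.le
    have hN : ∀ g ∈ Finset.range (n + 1), insSum q A r (n + 1) (insN n g w) = 0 := fun g hg => by
      have hg : g ≤ n := Nat.lt_succ_iff.1 (Finset.mem_range.1 hg)
      exact insSum_insN_eq_zero q hw hg (h.badN g hg) r
    rw [insSum, Finset.sum_add_distrib, Finset.sum_eq_zero hN, add_zero, Finset.sum_range_succ,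
      ih h.insP_self ((desOK_insP_iff hw le_rfl).2 ⟨hd, fun h' => by
        have := went_le hw; omega⟩),
      sum_range_eq_sum_Icc_sub h1 fun g hg => insSum_insP_eq_zero q hw (by omega)
        ((h.badP g (by omega)).2 hg) r]
    have hlast := h.last
    simp only [psi, Finset.sum_add_distrib]
    rw [← Finset.sum_Ico_add' (fun i => psi q A r (n + 1) true i)]
    by_cases hl : l = true ∧ ¬ A n
    · simp only [if_pos hl]
      rw [Finset.sum_eq_zero]
      · simp
      · intro i hi
        rw [Finset.mem_Icc] at hi
        refine insSum_eq_zero q (hw.insP (by omega)) ?_ r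
        rw [if_pos hl.1] at hlast
        rw [desOK_insP_iff hw (by omega), hlast]
        have : ((n - i : ℕ) : ℤ) < n := by omega
        tauto
    · simp only [if_neg hl]
      have hv : ∀ i ∈ Finset.Icc 1 s, insSum q A r (n + 1) (insP n (n - i) w) =
          q ^ b * (q ^ (t - i) * (psi q A r (n + 1) false i +
            (1 - q) * ∑ j ∈ Finset.Ico 1 i, psi q A r (n + 1) false j)) := fun i hi => by
        rw [Finset.mem_Icc] at hi
        rw [ih (h.insP_lt (show M ≤ n - i by omega) (by omega))
          ((desOK_insP_iff hw (by omega)).2 ⟨hd, fun h' => ?_⟩), show n - (n - i) = i by omega]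
        · ring
        · by_contra hA
          rw [if_neg (by tauto)] at hlast
          omega
      rw [Finset.sum_congr rfl hv, ← Finset.mul_sum, sum_pow_mul_eq q _ h3]
      ring

lemma insSum_free (r : ℕ) (h : IsFree n w l) (hd : DesOK A n w) :
    insSum q A r n w = freeVal q A r n l := by
  induction r generalizing n w l with
  | zero =>
    rw [insSum, if_pos ⟨h.fc, h.neg, hd⟩, freeVal, Finset.filter_true_of_mem, Nat.card_Icc]
    · simp
    · intro p hp
      rw [Finset.mem_Icc] at hp
      exact h.cut p hp.1 hp.2
  | succ r ih =>
    have hw := h.fc.inB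
    have hn := h.pos
    have hN : ∀ g ∈ Finset.range n, insSum q A r (n + 1) (insN n (g + 1) w) = 0 := fun g hg => by
      have hg := Finset.mem_range.1 hg
      exact insSum_insN_eq_zero q hw hg ((h.badN _ hg).2 (by omega)) r
    rw [insSum, Finset.sum_add_distrib, Finset.sum_range_succ' (n := n)
      (f := fun g => insSum q A r (n + 1) (insN n g w)), Finset.sum_eq_zero hN, zero_add,
      Finset.sum_range_succ,
      ih h.insP_self ((desOK_insP_iff hw le_rfl).2 ⟨hd, fun h' => by
        have := went_le hw; omega⟩),
      sum_range_eq_sum_Icc_sub (zero_add n).symm (by simp), freeVal]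
    have hlast := h.last
    by_cases hl : l = true ∧ ¬ A n
    · rw [if_pos hl]
      rw [if_pos hl.1] at hlast
      rw [Finset.sum_eq_zero, insSum_eq_zero q (hw.insN (by omega))]
      · simp
      · rw [desOK_insN_iff hw (by omega), hlast]
        have : -((0 : ℕ) : ℤ) ≤ n := by omega
        tauto
      · intro i hi
        rw [Finset.mem_Icc] at hi
        refine insSum_eq_zero q (hw.insP (by omega)) ?_ r
        rw [desOK_insP_iff hw (by omega), hlast]
        have : ((n - i : ℕ) : ℤ) < n := by omega
        tauto
    · rw [if_neg hl]
      have hA : 0 ≤ went w n → A n := fun h' => by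
        by_contra hA
        rw [if_neg (by tauto)] at hlast
        omega
      have hv : ∀ i ∈ Finset.Icc 1 n, insSum q A r (n + 1) (insP n (n - i) w) =
          q ^ (n - i) * (psi q A r (n + 1) false i +
            (1 - q) * ∑ j ∈ Finset.Ico 1 i, psi q A r (n + 1) false j) := fun i hi => by
        rw [Finset.mem_Icc] at hi
        rw [insSum_stuck q r (h.insP_lt (show n - i < n by omega))
          ((desOK_insP_iff hw (by omega)).2 ⟨hd, fun h' => hA (by omega)⟩),
          show n - (n - i) = i by omega]
      rw [Finset.sum_congr rfl hv, sum_pow_mul_eq q _ le_rfl, ih h.insN_zero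
        ((desOK_insN_iff hw (by omega)).2 ⟨hd, fun h' => hA (by omega)⟩)]
      simp
      ring

lemma not_badP_one : ¬ BadP n 1 g := by
  rintro (⟨i, j, h1, h2, h3, h4, h5⟩ | ⟨i, j, h1, h2, h3, h4, h5⟩) <;>
    simp only [Equiv.Perm.one_apply, Nat.abs_cast] at h4 <;> omega

lemma not_badN_one : ¬ BadN n 1 g := by
  rintro (⟨i, h1, h2, h3, h4⟩ | ⟨i, j, h1, h2, h3, h4, h5⟩ | ⟨i, j, h1, h2, h3, h4⟩) <;>
    simp only [Equiv.Perm.one_apply, Nat.abs_cast] at h4 <;> omega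

lemma cut_one (p : ℕ) : Cut n 1 p := fun j hj k hk => by
  rw [Finset.mem_Icc] at hj hk
  simp only [inv_one, Equiv.Perm.one_apply]
  omega

lemma isFC_one (n : ℕ) : IsFC n 1 := by
  refine ⟨InB.one n, ?_, ?_, ?_⟩
  · rintro ⟨i, j, h1, h2, h3, h4, h5⟩
    simp only [Equiv.Perm.one_apply] at h4
    omega
  · rintro ⟨i, j, k, h1, h2, h3, h4, h5, h6⟩
    simp only [Equiv.Perm.one_apply, Nat.abs_cast] at h5
    omega
  · rintro ⟨i, j, k, h1, h2, h3, h4, h5, h6⟩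
    simp only [Equiv.Perm.one_apply, Nat.abs_cast] at h5
    omega

lemma went_one (n : ℕ) : went 1 n = n := by
  unfold went
  split_ifs with h <;> simp [h]

lemma desOK_one (A : ℕ → Prop) (n : ℕ) : DesOK A n 1 := by
  rw [desOK_iff]
  intro j _ h
  rw [went_one, went_one] at h
  omega

lemma not_negSet_one : ¬ (NegSet n 1).Nonempty := by
  rw [negSet_nonempty_iff]
  rintro ⟨i, h1, h2, h3⟩
  simp only [Equiv.Perm.one_apply] at h3
  omega

lemma insP_self_one (n : ℕ) : insP n n 1 = 1 := by
  refine Equiv.ext fun i => ?_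
  rw [insP, mul_one, rotate_apply le_rfl, Equiv.Perm.one_apply]
  split_ifs <;> omega

lemma isFree_insN_one (n : ℕ) : IsFree (n + 1) (insN n 0 1) false := by
  have hw := InB.one n
  have h0 : 0 ≤ n := by omega
  refine ⟨(isFC_insN_iff hw h0).2 ⟨isFC_one n, not_badN_one⟩, negSet_insN_nonempty hw h0,
    fun g hg => ?_, fun g hg => ?_, fun p hp hpn => ?_, ?_⟩
  · rw [badP_insN_iff hw h0]
    simpa using not_badP_one
  · rw [badN_insN_iff hw h0, iff_false_intro not_badN_one, false_or]
    omega
  · exact (cut_insN_iff hw h0 hp).2 ⟨by omega, cut_one _⟩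
  · rw [if_neg (by simp), went_insN_succ hw h0]; simp

lemma isStuck_insN_one (h1 : 1 ≤ g) (hg : g ≤ n) :
    IsStuck (n + 1) (insN n g 1) g (n + 1 - g) (n + 1 - g) 0 false := by
  have hw := InB.one n
  refine ⟨(isFC_insN_iff hw hg).2 ⟨isFC_one n, not_badN_one⟩, negSet_insN_nonempty hw hg,
    by omega, by omega, le_rfl, fun g' hg' => ?_, fun g' hg' => ?_, fun p hp hpn => ?_, ?_, ?_⟩
  · rw [badP_insN_iff hw hg, iff_false_intro not_badP_one, false_or]
  · exact (badN_insN_iff hw hg).2 (by omega)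
  · rw [cut_insN_iff hw hg (by omega), iff_true_intro (cut_one _), and_true]
    omega
  · rw [Finset.card_eq_zero, Finset.filter_eq_empty_iff]
    intro p hp
    rw [Finset.mem_Icc] at hp
    rw [cut_insN_iff hw hg hp.1]
    omega
  · rw [if_neg (by simp), went_insN_succ hw hg]; omega

lemma insSum_one (r n : ℕ) : insSum q A r n 1 = idVal q A r n := by
  induction r generalizing n with
  | zero => exact if_neg fun h => not_negSet_one h.2.1
  | succ r ih =>
    have hw := InB.one n
    have hP : ∀ g ∈ Finset.range n, insSum q A r (n + 1) (insP n g 1) = 0 := fun g hg => by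
      have hg := Finset.mem_range.1 hg
      exact insSum_eq_zero_of_badN q (hw.insP hg.le)
        (by rw [negSet_insP_nonempty_iff hw hg.le]; exact not_negSet_one)
        (fun g' _ => (badN_insP_iff hw hg.le).2 (Or.inr hg)) r
    rw [insSum, Finset.sum_add_distrib, Finset.sum_range_succ, Finset.sum_eq_zero hP, zero_add,
      insP_self_one, ih, idVal]
    congr 1
    by_cases hA : A n
    · rw [if_neg (not_not.2 hA), Finset.sum_range_succ', add_comm,
        insSum_free q r (isFree_insN_one n)
          ((desOK_insN_iff hw (by omega)).2 ⟨desOK_one A n, fun _ => hA⟩)]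
      congr 1
      have hv : ∀ g ∈ Finset.range n, insSum q A r (n + 1) (insN n (g + 1) 1) =
          psi q A r (n + 1) false (n - g) := fun g hg => by
        have hg := Finset.mem_range.1 hg
        rw [insSum_stuck q r (isStuck_insN_one (by omega) hg)
          ((desOK_insN_iff hw hg).2 ⟨desOK_one A n, fun _ => hA⟩),
          show n + 1 - (g + 1) = n - g by omega]
        simp
      rw [Finset.sum_congr rfl hv, sum_range_eq_sum_Icc_sub (zero_add n).symm (by simp)]
      refine Finset.sum_congr rfl fun i hi => ?_
      rw [Finset.mem_Icc] at hi
      rw [show n - (n - i) = i by omega]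
    · rw [if_pos hA]
      refine Finset.sum_eq_zero fun g hg => ?_
      have hg : g ≤ n := Nat.lt_succ_iff.1 (Finset.mem_range.1 hg)
      refine insSum_eq_zero q (hw.insN hg) ?_ r
      rw [desOK_insN_iff hw hg, went_one]
      have : -(g : ℤ) ≤ n := by omega
      tauto

end States

section Coefficients

open Finset

/-- `n` is a partial sum of the exponent sequence `m`. -/
def IsPartialSum (m : ℕ →₀ ℕ) (n : ℕ) : Prop := ∃ v, ∑ u ∈ range (v + 1), m u = n

variable {m : ℕ →₀ ℕ} {n : ℕ} {J : Finset ℕ}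

lemma sum_range_succ_eq_degree (m : ℕ →₀ ℕ) {v : ℕ} (hv : m.support.sup id ≤ v) :
    ∑ u ∈ range (v + 1), m u = m.degree := by
  rw [Finsupp.degree_apply]
  refine (sum_subset (fun u hu => mem_range.2 ?_) fun u _ hu => ?_).symm
  · exact Nat.lt_succ_of_le ((le_sup (f := id) hu).trans hv)
  · simpa using hu

lemma sum_range_succ_le_degree (m : ℕ →₀ ℕ) (v : ℕ) :
    ∑ u ∈ range (v + 1), m u ≤ m.degree := by
  rw [← sum_range_succ_eq_degree m (le_max_right v _)]
  exact sum_le_sum_of_subset (range_subset_range.2 (by omega))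

section

variable {f : ℕ → ℕ} (hmono : ∀ a b, a ≤ b → b ≤ n → f a ≤ f b)
  (hcount : ∀ v : ℕ, m v = ((Icc 1 n).filter fun a => f a = v).card)

include hcount in
lemma card_le_eq_sum (v : ℕ) :
    ((Icc 1 n).filter fun a => f a ≤ v).card = ∑ u ∈ range (v + 1), m u := by
  rw [card_eq_sum_card_fiberwise (f := f) (t := range (v + 1))]
  · refine sum_congr rfl fun u hu => ?_
    rw [hcount, filter_filter]
    congr 2
    ext a
    rw [mem_range] at hu
    exact ⟨fun h => h.2, fun h => ⟨by omega, h⟩⟩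
  · intro a ha
    simp only [coe_filter, Set.mem_ofPred_eq] at ha
    simpa [Nat.lt_succ_iff] using ha.2

include hmono hcount in
lemma le_iff_le_sum {a : ℕ} (ha : 1 ≤ a) (han : a ≤ n) (v : ℕ) :
    f a ≤ v ↔ a ≤ ∑ u ∈ range (v + 1), m u := by
  rw [← card_le_eq_sum hcount]
  constructor
  · intro h
    have : Icc 1 a ⊆ (Icc 1 n).filter fun b => f b ≤ v := fun b hb => by
      rw [mem_Icc] at hb
      exact mem_filter.2 ⟨mem_Icc.2 (by omega), (hmono b a hb.2 han).trans h⟩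
    simpa using card_le_card this
  · intro h
    by_contra hlt
    have : ((Icc 1 n).filter fun b => f b ≤ v) ⊆ Icc 1 (a - 1) := fun b hb => by
      rw [mem_filter, mem_Icc] at hb
      rw [mem_Icc]
      by_contra hba
      have := hmono a b (by omega) hb.1.2
      omega
    have := card_le_card this
    rw [Nat.card_Icc] at this
    omega

include hmono hcount in
lemma degree_eq_of_count : m.degree = n := by
  rw [← sum_range_succ_eq_degree m (le_max_right (f n) _), ← card_le_eq_sum hcount,
    filter_true_of_mem, Nat.card_Icc]
  · omega
  · intro a ha
    rw [mem_Icc] at ha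
    exact (hmono a n ha.2 le_rfl).trans (le_max_left _ _)

end

/-- The weakly increasing sequence in which each `v` occurs `m v` times. -/
def sortedSeq (m : ℕ →₀ ℕ) (a : ℕ) : ℕ :=
  if 1 ≤ a ∧ a ≤ m.degree then sInf {v | a ≤ ∑ u ∈ range (v + 1), m u} else 0

lemma sortedSeq_le_iff {a : ℕ} (ha : 1 ≤ a) (ham : a ≤ m.degree) (v : ℕ) :
    sortedSeq m a ≤ v ↔ a ≤ ∑ u ∈ range (v + 1), m u := by
  have hne : {v | a ≤ ∑ u ∈ range (v + 1), m u}.Nonempty :=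
    ⟨_, by rwa [Set.mem_ofPred_eq, sum_range_succ_eq_degree m le_rfl]⟩
  rw [sortedSeq, if_pos ⟨ha, ham⟩]
  refine ⟨fun h => ?_, fun h => Nat.sInf_le h⟩
  exact (Nat.sInf_mem hne).trans (sum_le_sum_of_subset (range_subset_range.2 (by omega)))

lemma sortedSeq_zero : sortedSeq m 0 = 0 := if_neg (by omega)

lemma sortedSeq_mono {a b : ℕ} (hab : a ≤ b) (hb : b ≤ m.degree) :
    sortedSeq m a ≤ sortedSeq m b := by
  rcases Nat.eq_zero_or_pos a with rfl | ha
  · rw [sortedSeq_zero]; exact Nat.zero_le _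
  · rw [sortedSeq_le_iff ha (hab.trans hb)]
    exact hab.trans ((sortedSeq_le_iff (by omega) hb _).1 le_rfl)

lemma card_sortedSeq_eq (v : ℕ) :
    m v = ((Icc 1 m.degree).filter fun a => sortedSeq m a = v).card := by
  have hle := sum_range_succ_le_degree m v
  rcases v with _ | v
  · rw [show ((Icc 1 m.degree).filter fun a => sortedSeq m a = 0) = Icc 1 (m 0) from ?_]
    · simp
    · ext a
      rw [mem_filter, mem_Icc, mem_Icc]
      constructor
      · rintro ⟨h1, h2⟩
        simpa [h1.1] using (sortedSeq_le_iff h1.1 h1.2 0).1 h2.le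
      · intro h
        rw [zero_add, sum_range_one] at hle
        refine ⟨by omega, Nat.le_zero.1 ((sortedSeq_le_iff h.1 (by omega) 0).2 ?_)⟩
        simpa using h.2
  · rw [sum_range_succ] at hle
    rw [show ((Icc 1 m.degree).filter fun a => sortedSeq m a = v + 1) =
      Ioc (∑ u ∈ range (v + 1), m u) (∑ u ∈ range (v + 1), m u + m (v + 1)) from ?_]
    · simp
    · ext a
      rw [mem_filter, mem_Icc, mem_Ioc, ← sum_range_succ]
      rw [← sum_range_succ] at hle
      constructor
      · rintro ⟨h1, h2⟩
        rw [← sortedSeq_le_iff h1.1 h1.2, ← not_le, ← sortedSeq_le_iff h1.1 h1.2]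
        omega
      · intro h
        have h1 : 1 ≤ a ∧ a ≤ m.degree := by omega
        rw [← sortedSeq_le_iff h1.1 h1.2, ← not_le, ← sortedSeq_le_iff h1.1 h1.2] at h
        exact ⟨h1, by omega⟩

lemma FB_apply (R : Type) [CommRing R] (hJ : ∀ j ∈ J, j < n) (m : ℕ →₀ ℕ) :
    FB R n J m = if m.degree = n ∧ ∀ j ∈ J, IsPartialSum m j then 1 else 0 := by
  unfold FB
  split_ifs with h
  · obtain ⟨rfl, hA⟩ := h
    rw [Nat.card_eq_one_iff_unique.2, Nat.cast_one]
    refine ⟨⟨fun f f' => Subtype.ext (funext fun a => ?_)⟩, ⟨sortedSeq m, sortedSeq_zero,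
      fun a ha => if_neg (by omega), fun a b => sortedSeq_mono, fun j hj => ?_,
      card_sortedSeq_eq⟩⟩
    · obtain ⟨f, h0, hlt, hmono, -, hcount⟩ := f
      obtain ⟨f', h0', hlt', hmono', -, hcount'⟩ := f'
      rcases Nat.eq_zero_or_pos a with rfl | ha
      · exact h0.trans h0'.symm
      · rcases Nat.lt_or_ge m.degree a with h1 | h1
        · exact (hlt a h1).trans (hlt' a h1).symm
        · refine eq_of_forall_ge_iff fun v => ?_
          rw [le_iff_le_sum hmono hcount ha h1, le_iff_le_sum hmono' hcount' ha h1]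
    · obtain ⟨v, hv⟩ := hA j hj
      have h1 := sortedSeq_le_iff (m := m) (a := j + 1) (by omega) (hJ j hj) v
      have h2 : sortedSeq m j ≤ v := by
        rcases Nat.eq_zero_or_pos j with rfl | hj'
        · rw [sortedSeq_zero]; exact Nat.zero_le _
        · exact (sortedSeq_le_iff hj' (hJ j hj).le v).2 hv.ge
      omega
  · rw [Nat.card_eq_zero.2, Nat.cast_zero]
    refine Or.inl ⟨fun ⟨f, h0, hlt, hmono, hdes, hcount⟩ => h ⟨degree_eq_of_count hmono hcount,
      fun j hj => ⟨f j, ?_⟩⟩⟩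
    have h1 := le_iff_le_sum hmono hcount (a := j + 1) (by omega) (hJ j hj) (f j)
    have h2 := hdes j hj
    rcases Nat.eq_zero_or_pos j with rfl | hj'
    · omega
    · have h3 := (le_iff_le_sum hmono hcount hj' (hJ j hj).le (f j)).1 le_rfl
      omega

lemma sum_antidiagonal_eq_sum_Iic {M : Type*} [AddCommMonoid M] (m : ℕ →₀ ℕ)
    (F : (ℕ →₀ ℕ) → M) :
    ∑ p ∈ antidiagonal m, (if p.1 0 = 0 then F p.1 else 0) = ∑ x ∈ Iic (m.erase 0), F x := by
  have hle : ∀ x : ℕ →₀ ℕ, x ≤ m.erase 0 ↔ x 0 = 0 ∧ x ≤ m := fun x => by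
    simp only [Finsupp.le_def, Finsupp.erase_apply]
    constructor
    · intro h
      exact ⟨by simpa using h 0, fun i => (h i).trans (by split_ifs <;> simp)⟩
    · rintro ⟨h0, h⟩ i
      split_ifs with hi
      · rw [hi, h0]
      · exact h i
  rw [← sum_filter]
  refine sum_nbij' Prod.fst (fun x => (x, m - x)) ?_ ?_ ?_ ?_ ?_
  · rintro p hp
    rw [mem_filter, HasAntidiagonal.mem_antidiagonal] at hp
    rw [mem_Iic, hle, ← hp.1]
    exact ⟨hp.2, le_self_add⟩
  · intro x hx
    rw [mem_Iic, hle] at hx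
    rw [mem_filter, HasAntidiagonal.mem_antidiagonal]
    exact ⟨add_tsub_cancel_of_le hx.2, hx.1⟩
  · rintro ⟨p, p'⟩ hp
    rw [mem_filter, HasAntidiagonal.mem_antidiagonal] at hp
    simp [← hp.1]
  · intro x _
    rfl
  · intro p _
    rfl

lemma coeff_hSeries (R : Type) [CommRing R] (s k : ℕ) (m : ℕ →₀ ℕ) :
    MvPowerSeries.coeff m (hSeries R s k) =
      if m.degree = k ∧ ∀ a < s, m a = 0 then 1 else 0 := rfl

lemma sum_coeff_hSeries_mul (R : Type) [CommRing R] (β : ℕ → R) (n : ℕ) (m : ℕ →₀ ℕ) :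
    ∑ k ∈ Icc 1 n, β k * MvPowerSeries.coeff m (hSeries R 1 k * hSeries R 0 (n - k)) =
      if m.degree = n then ∑ x ∈ Iic (m.erase 0), β x.degree - β 0 else 0 := by
  have hx : ∑ x ∈ Iic (m.erase 0), β x.degree - β 0 =
      ∑ x ∈ Iic (m.erase 0), if x = 0 then 0 else β x.degree := by
    have h0 : (0 : ℕ →₀ ℕ) ∈ Iic (m.erase 0) := mem_Iic.2 zero_le
    rw [← add_sum_erase _ _ h0, ← add_sum_erase _ _ h0, if_pos rfl, map_zero, zero_add,
      add_sub_cancel_left]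
    exact sum_congr rfl fun x hx => (if_neg (ne_of_mem_erase hx)).symm
  rw [hx, ← sum_antidiagonal_eq_sum_Iic]
  simp only [MvPowerSeries.coeff_mul, mul_sum]
  rw [sum_comm]
  have hinner : ∀ p ∈ antidiagonal m, ∑ k ∈ Icc 1 n, β k *
      (MvPowerSeries.coeff p.1 (hSeries R 1 k) * MvPowerSeries.coeff p.2 (hSeries R 0 (n - k))) =
        if m.degree = n then if p.1 0 = 0 then if p.1 = 0 then 0 else β p.1.degree else 0
        else 0 := fun p hp => by
    rw [HasAntidiagonal.mem_antidiagonal] at hp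
    have hdeg : p.1.degree + p.2.degree = m.degree := by rw [← map_add, hp]
    have h0 : p.1 = 0 ↔ p.1.degree = 0 := (Finsupp.degree_eq_zero_iff _).symm
    simp only [coeff_hSeries, Nat.lt_one_iff, forall_eq, not_lt_zero, false_imp_iff, forall_const,
      and_true, h0]
    split_ifs with h1 h2 h3
    · refine sum_eq_zero fun k hk => ?_
      rw [mem_Icc] at hk
      rw [if_neg (by omega), zero_mul, mul_zero]
    · rw [sum_eq_single p.1.degree, if_pos ⟨rfl, h2⟩, if_pos (by omega), mul_one, mul_one]
      · intro k _ hk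
        rw [if_neg (by tauto), zero_mul, mul_zero]
      · intro hk
        rw [mem_Icc] at hk
        omega
    · exact sum_eq_zero fun k _ => by rw [if_neg (by tauto), zero_mul, mul_zero]
    · refine sum_eq_zero fun k hk => ?_
      rw [mem_Icc] at hk
      rcases eq_or_ne p.1.degree k with h4 | h4
      · rw [if_neg (show p.2.degree ≠ n - k by omega), mul_zero, mul_zero]
      · rw [if_neg (by tauto), zero_mul, mul_zero]
  rw [sum_congr rfl hinner]
  split_ifs
  · rfl
  · exact sum_const_zero

end Coefficients

lemma sum_coeff_FB (n : ℕ) (hn : 0 < n) (m : ℕ →₀ ℕ) :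
    ∑ w ∈ (signedPerms n).filter (fun w => IsFC n w ∧ (NegSet n w).Nonempty),
        (Polynomial.X ^ bl n w⁻¹ : Polynomial ℤ) *
          MvPowerSeries.coeff m (FB (Polynomial ℤ) n (DesB n w)) =
      if m.degree = n then idVal Polynomial.X (IsPartialSum m) n 0 else 0 := by
  have hc : ∀ w, MvPowerSeries.coeff m (FB (Polynomial ℤ) n (DesB n w)) =
      if m.degree = n ∧ DesOK (IsPartialSum m) n w then 1 else 0 := fun w => by
    refine (FB_apply (J := DesB n w) _
      (fun j hj => Finset.mem_range.1 (Finset.mem_filter.1 hj).1) m).trans ?_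
    congr 1
  simp only [hc]
  split_ifs with h
  · have hs := sum_insSum (Polynomial.X : Polynomial ℤ) (IsPartialSum m) n 0
    rw [zero_add, signedPerms, Finset.sum_singleton, insSum_one] at hs
    rw [hs, Finset.sum_filter]
    refine Finset.sum_congr rfl fun w _ => ?_
    rw [insSum, bl_inv hn]
    by_cases h1 : IsFC n w ∧ (NegSet n w).Nonempty
    · by_cases h2 : DesOK (IsPartialSum m) n w <;> simp [h1, h2, h]
    · rw [if_neg h1, if_neg (by tauto)]
  · exact Finset.sum_eq_zero fun w _ => by rw [if_neg (by tauto), mul_zero]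

theorem chow_generating_function_FC_Bn_minus_Sn (n : ℕ) (hn : 0 < n) :
    (∑ᶠ w ∈ {w : Equiv.Perm ℤ | IsFC n w ∧ (NegSet n w).Nonempty},
        (Polynomial.X ^ bl n w⁻¹ : Polynomial ℤ) • FB (Polynomial ℤ) n (DesB n w)) =
      ∑ k ∈ Finset.Icc 1 n,
        (∑ j ∈ Finset.range (n + 1), (bCoeff n k j : Polynomial ℤ) * Polynomial.X ^ j) •
          (hSeries (Polynomial ℤ) 1 k * hSeries (Polynomial ℤ) 0 (n - k)) := by
  have hset : {w : Equiv.Perm ℤ | IsFC n w ∧ (NegSet n w).Nonempty} =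
      ↑((signedPerms n).filter fun w => IsFC n w ∧ (NegSet n w).Nonempty) := by
    ext w
    simp only [Set.mem_ofPred_eq, Finset.coe_filter, mem_signedPerms]
    exact ⟨fun h => ⟨h.1.inB, h⟩, And.right⟩
  rw [hset, finsum_mem_coe_finset]
  ext1 m
  simp only [map_sum, MvPowerSeries.coeff_smul]
  rw [sum_coeff_FB n hn, Finset.sum_congr rfl fun k hk => by
      rw [sum_bCoeff (Finset.mem_Icc.1 hk).2],
    sum_coeff_hSeries_mul _ fun k => gammaSum n k (fun s => Polynomial.X ^ s) + Polynomial.X ^ n]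
  split_ifs with h
  · subst h
    rw [gammaSum_zero_right, zero_add]
    exact idVal_eq_sum Polynomial.X m
  · rfl

end Paper
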